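/- arXiv:1501.07371 — 2 statements merged into one kernel-verified Lean document; each statement's English description precedes it below -/
import Mathlib

section
/- There exists D > 0 depending only on C₀ such that the following holds: if ε, β > 0 satisfy β ≤ D²ε⁴ and u is an admissible solution of (★) whose initial datum satisfies the data bounds with constant C₀, then there is a constant C depending only on C₀ such that for every t > 0: βε ∫₀ᵗ‖∂_t∂_x u(s,·)‖²_{L²(ℝ)} ds ≤ C, β²ε ∫₀ᵗ‖∂_t∂_x² u(s,·)‖²_{L²(ℝ)} ds ≤ C, β³ε ∫₀ᵗ‖∂_t∂_x³ u(s,·)‖²_{L²(ℝ)} ds ≤ C, β²ε ∫₀ᵗ‖∂_x³ u(s,·)‖²_{L²(ℝ)} ds ≤ C, ε ∫₀ᵗ‖u(s,·)∂_x u(s,·)‖²_{L²(ℝ)} ds ≤ C, and ε³ ∫₀ᵗ‖∂_x² u(s,·)‖²_{L²(ℝ)} ds ≤ C. -/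
open MeasureTheory Real Filter Set

noncomputable section

/-- `mixedD u j k t x`: `j` time derivatives of the `k`-th spatial derivative of `u` at `(t,x)`. -/
def mixedD (u : ℝ → ℝ → ℝ) (j k : ℕ) (t x : ℝ) : ℝ :=
  iteratedDeriv j (fun s => iteratedDeriv k (fun y => u s y) x) t

/-- Squared `L²` norm in the space variable. -/
def sqL2 (f : ℝ → ℝ) : ℝ := ∫ x : ℝ, (f x) ^ 2

/-- `L²` norm in the space variable. -/
def nL2 (f : ℝ → ℝ) : ℝ := Real.sqrt (∫ x : ℝ, (f x) ^ 2)

/-- `L⁴` norm in the space variable. -/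
def nL4 (f : ℝ → ℝ) : ℝ := (∫ x : ℝ, (f x) ^ 4) ^ ((1 : ℝ) / 4)

/-- Admissible solution of the Rosenau–KdV–RLW approximation (★). -/
structure IsAdmissibleKdVRLW (ε β : ℝ) (u : ℝ → ℝ → ℝ) : Prop where
  smooth : ContDiff ℝ (⊤ : ℕ∞) (fun p : ℝ × ℝ => u p.1 p.2)
  pde : ∀ t > (0 : ℝ), ∀ x : ℝ,
    mixedD u 1 0 t x + deriv (fun y => (u t y) ^ 2) x
      + β * mixedD u 0 3 t x - β * mixedD u 1 2 t x
      + β ^ 2 * mixedD u 1 4 t x = ε * mixedD u 0 2 t x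
  sq_int : ∀ T > (0 : ℝ), ∀ j k : ℕ, j + k ≤ 5 → ∀ t ∈ Set.Icc (0 : ℝ) T,
    MeasureTheory.Integrable (fun x : ℝ => (mixedD u j k t x) ^ 2)
  decay : ∀ T > (0 : ℝ), ∀ j k : ℕ, j + k ≤ 5 → ∀ δ > (0 : ℝ), ∃ M : ℝ,
    ∀ x : ℝ, M ≤ |x| → ∀ t ∈ Set.Icc (0 : ℝ) T, |mixedD u j k t x| ≤ δ

/-- Admissible solution of the Rosenau–RLW approximation (★★). -/
structure IsAdmissibleRLW (ε β : ℝ) (u : ℝ → ℝ → ℝ) : Prop where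
  smooth : ContDiff ℝ (⊤ : ℕ∞) (fun p : ℝ × ℝ => u p.1 p.2)
  pde : ∀ t > (0 : ℝ), ∀ x : ℝ,
    mixedD u 1 0 t x + deriv (fun y => (u t y) ^ 2) x
      - β * mixedD u 1 2 t x + β ^ 2 * mixedD u 1 4 t x = ε * mixedD u 0 2 t x
  sq_int : ∀ T > (0 : ℝ), ∀ j k : ℕ, j + k ≤ 5 → ∀ t ∈ Set.Icc (0 : ℝ) T,
    MeasureTheory.Integrable (fun x : ℝ => (mixedD u j k t x) ^ 2)
  decay : ∀ T > (0 : ℝ), ∀ j k : ℕ, j + k ≤ 5 → ∀ δ > (0 : ℝ), ∃ M : ℝ,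
    ∀ x : ℝ, M ≤ |x| → ∀ t ∈ Set.Icc (0 : ℝ) T, |mixedD u j k t x| ≤ δ

/-- Data bounds with constant `C0` for the (★) approximation. -/
def DataBoundsKdVRLW (ε β C0 : ℝ) (f : ℝ → ℝ) : Prop :=
  (∫ x : ℝ, (f x) ^ 2) + (∫ x : ℝ, (f x) ^ 4)
      + (β + ε ^ 2) * (∫ x : ℝ, (deriv f x) ^ 2) ≤ C0 ∧
  (β * ε + β * ε ^ 2 + β ^ 2) * (∫ x : ℝ, (iteratedDeriv 2 f x) ^ 2)
      + (β ^ 2 * ε ^ 2 + β ^ 3) * (∫ x : ℝ, (iteratedDeriv 3 f x) ^ 2) ≤ C0 ∧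
  β ^ 4 * (∫ x : ℝ, (iteratedDeriv 4 f x) ^ 2) ≤ C0

/-- Data bounds with constant `C0` for the (★★) approximation. -/
def DataBoundsRLW (ε β C0 : ℝ) (f : ℝ → ℝ) : Prop :=
  (∫ x : ℝ, (f x) ^ 2) + (∫ x : ℝ, (f x) ^ 4)
    + β * ε ^ 2 * (∫ x : ℝ, (iteratedDeriv 2 f x) ^ 2) ≤ C0

/-- `u ∈ L^∞((0,∞); L²(ℝ) ∩ L⁴(ℝ))`. -/
def BddL2L4 (u : ℝ → ℝ → ℝ) : Prop :=
  ∃ M : ℝ, ∀ t > (0 : ℝ), (∫ x : ℝ, (u t x) ^ 2) ≤ M ∧ (∫ x : ℝ, (u t x) ^ 4) ≤ M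

/-- Entropy solution of `∂ₜ u + ∂ₓ (u²) = 0` with initial datum `u0`. -/
def IsEntropySolution (u : ℝ → ℝ → ℝ) (u0 : ℝ → ℝ) : Prop :=
  ∀ η : ℝ → ℝ, ContDiff ℝ 2 η → ConvexOn ℝ Set.univ η →
    (∃ M : ℝ, ∀ v : ℝ, |deriv η v| ≤ M) →
    ∀ φ : ℝ → ℝ → ℝ, ContDiff ℝ (⊤ : ℕ∞) (fun p : ℝ × ℝ => φ p.1 p.2) →
      HasCompactSupport (fun p : ℝ × ℝ => φ p.1 p.2) →
      (∀ t x : ℝ, 0 ≤ φ t x) →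
      0 ≤ (∫ t in Set.Ioi (0 : ℝ), ∫ x : ℝ,
            (η (u t x) * deriv (fun s => φ s x) t
              + (∫ ξ in (0 : ℝ)..(u t x), 2 * ξ * deriv η ξ) * deriv (fun y => φ t y) x))
          + ∫ x : ℝ, η (u0 x) * φ 0 x

section Smooth

variable {u : ℝ → ℝ → ℝ}

theorem contDiff_deriv_fst {f : ℝ → ℝ → ℝ} (hf : ContDiff ℝ (⊤ : ℕ∞) (Function.uncurry f)) :
    ContDiff ℝ (⊤ : ℕ∞) (Function.uncurry fun t x => deriv (fun s => f s x) t) := by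
  have h : (Function.uncurry fun t x => deriv (fun s => f s x) t)
      = fun p : ℝ × ℝ => fderiv ℝ (Function.uncurry f) p (1, 0) := by
    ext ⟨t, x⟩
    have h1 := (hf.differentiable (by simp) (t, x)).hasFDerivAt
    have h2 : HasDerivAt (fun s : ℝ => (s, x)) ((1 : ℝ), (0 : ℝ)) t :=
      (hasDerivAt_id t).prodMk (hasDerivAt_const t x)
    exact (h1.comp_hasDerivAt t h2).deriv
  rw [h]
  exact (hf.fderiv_right (by simp)).clm_apply contDiff_const

theorem contDiff_deriv_snd {f : ℝ → ℝ → ℝ} (hf : ContDiff ℝ (⊤ : ℕ∞) (Function.uncurry f)) :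
    ContDiff ℝ (⊤ : ℕ∞) (Function.uncurry fun t x => deriv (f t) x) := by
  have h : (Function.uncurry fun t x => deriv (f t) x)
      = fun p : ℝ × ℝ => fderiv ℝ (Function.uncurry f) p (0, 1) := by
    ext ⟨t, x⟩
    have h1 := (hf.differentiable (by simp) (t, x)).hasFDerivAt
    have h2 : HasDerivAt (fun y : ℝ => (t, y)) ((0 : ℝ), (1 : ℝ)) x :=
      (hasDerivAt_const x t).prodMk (hasDerivAt_id x)
    exact (h1.comp_hasDerivAt x h2).deriv
  rw [h]
  exact (hf.fderiv_right (by simp)).clm_apply contDiff_const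

theorem deriv_fst_deriv_snd_comm {f : ℝ → ℝ → ℝ}
    (hf : ContDiff ℝ (⊤ : ℕ∞) (Function.uncurry f)) (t x : ℝ) :
    deriv (fun y => deriv (fun s => f s y) t) x = deriv (fun s => deriv (f s) x) t := by
  obtain ⟨g, hd, hg⟩ : ∃ g : ℝ × ℝ → (ℝ × ℝ →L[ℝ] ℝ),
      (∀ p, HasFDerivAt (Function.uncurry f) (g p) p) ∧ Differentiable ℝ g :=
    ⟨fderiv ℝ (Function.uncurry f), fun p => (hf.differentiable (by simp) p).hasFDerivAt,
      (hf.fderiv_right (m := (⊤ : ℕ∞)) (by simp)).differentiable (by simp)⟩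
  obtain ⟨g', hdd⟩ : ∃ g', HasFDerivAt g g' (t, x) := ⟨_, (hg (t, x)).hasFDerivAt⟩
  have h2 : ∀ t x : ℝ, HasDerivAt (fun s : ℝ => (s, x)) ((1 : ℝ), (0 : ℝ)) t := fun t x =>
    (hasDerivAt_id t).prodMk (hasDerivAt_const t x)
  have h3 : ∀ t x : ℝ, HasDerivAt (fun y : ℝ => (t, y)) ((0 : ℝ), (1 : ℝ)) x := fun t x =>
    (hasDerivAt_const x t).prodMk (hasDerivAt_id x)
  have e1 : (fun y => deriv (fun s => f s y) t) = fun y => g (t, y) (1, 0) := by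
    ext y
    exact ((hd (t, y)).comp_hasDerivAt t (h2 t y)).deriv
  have e2 : (fun s => deriv (f s) x) = fun s => g (s, x) (0, 1) := by
    ext s
    exact ((hd (s, x)).comp_hasDerivAt x (h3 s x)).deriv
  have k1 : HasDerivAt (fun y => g (t, y)) (g' (0, 1)) x := hdd.comp_hasDerivAt x (h3 t x)
  have k2 : HasDerivAt (fun s => g (s, x)) (g' (1, 0)) t := hdd.comp_hasDerivAt t (h2 t x)
  have g1 := (k1.clm_apply (hasDerivAt_const x ((1 : ℝ), (0 : ℝ)))).deriv
  have g2 := (k2.clm_apply (hasDerivAt_const t ((0 : ℝ), (1 : ℝ)))).deriv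
  rw [e1, e2, g1, g2, map_zero, add_zero, add_zero]
  exact second_derivative_symmetric hd hdd _ _

theorem mixedD_succ_left (j k : ℕ) (t x : ℝ) :
    mixedD u (j + 1) k t x = deriv (fun s => mixedD u j k s x) t := by
  simp only [mixedD, iteratedDeriv_succ]

theorem mixedD_zero_succ (k : ℕ) (t x : ℝ) :
    mixedD u 0 (k + 1) t x = deriv (mixedD u 0 k t) x := by
  simp only [mixedD, iteratedDeriv_zero, iteratedDeriv_succ]
  rfl

theorem mixedD_zero_zero (t x : ℝ) : mixedD u 0 0 t x = u t x := by
  simp [mixedD]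

theorem contDiff_mixedD (hu : ContDiff ℝ (⊤ : ℕ∞) (Function.uncurry u)) (j k : ℕ) :
    ContDiff ℝ (⊤ : ℕ∞) (Function.uncurry (mixedD u j k)) := by
  induction j with
  | zero =>
    induction k with
    | zero => simpa only [funext₂ (mixedD_zero_zero (u := u))] using hu
    | succ k ih =>
      simpa only [funext₂ (mixedD_zero_succ (u := u) k)] using contDiff_deriv_snd ih
  | succ j ih =>
    simpa only [funext₂ (mixedD_succ_left (u := u) j k)] using contDiff_deriv_fst ih

theorem mixedD_succ_right (hu : ContDiff ℝ (⊤ : ℕ∞) (Function.uncurry u)) (j k : ℕ) (t x : ℝ) :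
    mixedD u j (k + 1) t x = deriv (mixedD u j k t) x := by
  induction j generalizing t x with
  | zero => exact mixedD_zero_succ k t x
  | succ j ih =>
    rw [mixedD_succ_left, funext (mixedD_succ_left (u := u) j k t),
      deriv_fst_deriv_snd_comm (contDiff_mixedD hu j k)]
    simp only [ih]

theorem hasDerivAt_mixedD_fst (hu : ContDiff ℝ (⊤ : ℕ∞) (Function.uncurry u)) (j k : ℕ)
    (t x : ℝ) : HasDerivAt (fun s => mixedD u j k s x) (mixedD u (j + 1) k t x) t := by
  rw [mixedD_succ_left]
  have h : ContDiff ℝ (⊤ : ℕ∞) (fun s => mixedD u j k s x) :=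
    (contDiff_mixedD hu j k).comp (contDiff_id.prodMk contDiff_const)
  exact (h.differentiable (by simp) t).hasDerivAt

theorem hasDerivAt_mixedD_snd (hu : ContDiff ℝ (⊤ : ℕ∞) (Function.uncurry u)) (j k : ℕ)
    (t x : ℝ) : HasDerivAt (fun y => mixedD u j k t y) (mixedD u j (k + 1) t x) x := by
  rw [mixedD_succ_right hu]
  have h : ContDiff ℝ (⊤ : ℕ∞) (fun y => mixedD u j k t y) :=
    (contDiff_mixedD hu j k).comp (contDiff_const.prodMk contDiff_id)
  exact (h.differentiable (by simp) x).hasDerivAt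

end Smooth

section Box

theorem intervalIntegral_swap_of_continuous {f : ℝ → ℝ → ℝ}
    (hf : Continuous (Function.uncurry f)) {a b c d : ℝ} (hab : a ≤ b) (hcd : c ≤ d) :
    (∫ s in a..b, ∫ x in c..d, f s x) = ∫ x in c..d, ∫ s in a..b, f s x := by
  simp only [intervalIntegral.integral_of_le hab, intervalIntegral.integral_of_le hcd]
  apply integral_integral_swap
  rw [Measure.prod_restrict]
  exact (hf.continuousOn.integrableOn_compact (isCompact_Icc.prod isCompact_Icc)).mono_set
    (Set.prod_mono Ioc_subset_Icc_self Ioc_subset_Icc_self)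

/-- The integral of a local balance law over a space-time box. -/
theorem box_balance {e e' F F' Q : ℝ → ℝ → ℝ} {T R : ℝ} (hT : 0 ≤ T) (hR : 0 ≤ R)
    (he : ∀ t x, HasDerivAt (fun s => e s x) (e' t x) t)
    (hF : ∀ t x, HasDerivAt (F t) (F' t x) x)
    (ce : Continuous (Function.uncurry e)) (ce' : Continuous (Function.uncurry e'))
    (cF' : Continuous (Function.uncurry F'))
    (bal : ∀ t > 0, ∀ x, e' t x + F' t x + Q t x = 0) :
    (∫ x in -R..R, e T x) + (∫ s in (0 : ℝ)..T, ∫ x in -R..R, Q s x)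
      = (∫ x in -R..R, e 0 x) - ∫ s in (0 : ℝ)..T, (F s R - F s (-R)) := by
  have slice : ∀ {g : ℝ → ℝ → ℝ}, Continuous (Function.uncurry g) → ∀ s, Continuous (g s) :=
    fun hg s => hg.comp (continuous_const.prodMk continuous_id)
  have slice' : ∀ {g : ℝ → ℝ → ℝ}, Continuous (Function.uncurry g) → ∀ x,
      Continuous (fun s => g s x) := fun hg x => hg.comp (continuous_id.prodMk continuous_const)
  have h1 : (∫ x in -R..R, e T x) - (∫ x in -R..R, e 0 x)
      = ∫ s in (0 : ℝ)..T, ∫ x in -R..R, e' s x := by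
    rw [intervalIntegral_swap_of_continuous ce' hT (by linarith),
      ← intervalIntegral.integral_sub ((slice ce T).intervalIntegrable _ _)
        ((slice ce 0).intervalIntegrable _ _)]
    refine intervalIntegral.integral_congr fun x _ => ?_
    exact (intervalIntegral.integral_eq_sub_of_hasDerivAt (fun s _ => he s x)
      ((slice' ce' x).intervalIntegrable _ _)).symm
  have h2 : ∀ s, F s R - F s (-R) = ∫ x in -R..R, F' s x := fun s =>
    (intervalIntegral.integral_eq_sub_of_hasDerivAt (fun x _ => hF s x)
      ((slice cF' s).intervalIntegrable _ _)).symm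
  have par : ∀ {g : ℝ → ℝ → ℝ}, Continuous (Function.uncurry g) →
      IntervalIntegrable (fun s => ∫ x in -R..R, g s x) volume 0 T := fun hg =>
    (intervalIntegral.continuous_parametric_intervalIntegral_of_continuous' hg _ _
      ).intervalIntegrable _ _
  have h3 : (∫ s in (0 : ℝ)..T, ∫ x in -R..R, Q s x)
      = ∫ s in (0 : ℝ)..T, -((∫ x in -R..R, e' s x) + ∫ x in -R..R, F' s x) := by
    refine intervalIntegral.integral_congr_ae (Eventually.of_forall fun s hs => ?_)
    rw [uIoc_of_le hT] at hs
    rw [← intervalIntegral.integral_add ((slice ce' s).intervalIntegrable _ _)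
      ((slice cF' s).intervalIntegrable _ _), ← intervalIntegral.integral_neg]
    refine intervalIntegral.integral_congr fun x _ => ?_
    have := bal s hs.1 x
    linarith
  rw [intervalIntegral.integral_neg, intervalIntegral.integral_add (par ce') (par cF')] at h3
  simp only [h2]
  linarith

/-- A balance law with a flux vanishing at infinity, nonnegative energy density and nonnegative
dissipation density controls the energy and the dissipation on every box. -/
theorem box_energy_le {e e' F F' Q : ℝ → ℝ → ℝ} {T K : ℝ} (hT : 0 ≤ T)
    (he : ∀ t x, HasDerivAt (fun s => e s x) (e' t x) t)
    (hF : ∀ t x, HasDerivAt (F t) (F' t x) x)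
    (ce : Continuous (Function.uncurry e)) (ce' : Continuous (Function.uncurry e'))
    (cF' : Continuous (Function.uncurry F'))
    (cQ : Continuous (Function.uncurry Q))
    (bal : ∀ t > 0, ∀ x, e' t x + F' t x + Q t x = 0)
    (dec : Tendsto (Function.uncurry F) (𝓟 (Icc 0 T) ×ˢ cocompact ℝ) (nhds 0))
    (e0 : ∀ R > 0, ∫ x in -R..R, e 0 x ≤ K)
    (epos : ∀ t x, 0 ≤ e t x) (Qpos : ∀ t ∈ Ioc 0 T, ∀ x, 0 ≤ Q t x) {R : ℝ} (hR : 0 < R) :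
    (∫ x in -R..R, e T x) + (∫ s in (0 : ℝ)..T, ∫ x in -R..R, Q s x) ≤ K := by
  have slice : ∀ {g : ℝ → ℝ → ℝ}, Continuous (Function.uncurry g) → ∀ s, Continuous (g s) :=
    fun hg s => hg.comp (continuous_const.prodMk continuous_id)
  have par : ∀ {g : ℝ → ℝ → ℝ} (R : ℝ), Continuous (Function.uncurry g) →
      IntervalIntegrable (fun s => ∫ x in -R..R, g s x) volume 0 T := fun R hg =>
    (intervalIntegral.continuous_parametric_intervalIntegral_of_continuous' hg _ _
      ).intervalIntegrable _ _
  refine le_of_forall_pos_le_add fun δ hδ => ?_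
  set η := δ / (2 * (T + 1)) with hη
  have hη0 : 0 < η := by positivity
  have hηT : 2 * η * T ≤ δ := by
    rw [hη]; field_simp; nlinarith
  have hev := Metric.tendsto_nhds.mp dec η hη0
  rw [Filter.eventually_prod_iff] at hev
  obtain ⟨pa, hpa, pb, hpb, hab⟩ := hev
  rw [Metric.cobounded_eq_cocompact.symm, ← comap_norm_atTop, eventually_comap,
    eventually_atTop] at hpb
  obtain ⟨M, hM⟩ := hpb
  have hpa' : ∀ s ∈ Icc 0 T, pa s := hpa
  set S := max R M with hS
  have hS0 : 0 < S := lt_max_of_lt_left hR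
  have hFb : ∀ s ∈ Icc 0 T, |F s S| ≤ η ∧ |F s (-S)| ≤ η := by
    intro s hs
    have h1 := hab (hpa' s hs) (hM S (le_max_right _ _) S (by simp [abs_of_pos hS0]))
    have h2 := hab (hpa' s hs) (hM S (le_max_right _ _) (-S) (by simp [abs_of_pos hS0]))
    simp only [Real.dist_eq, sub_zero, Function.uncurry] at h1 h2
    exact ⟨h1.le, h2.le⟩
  have hflux : -(∫ s in (0 : ℝ)..T, (F s S - F s (-S))) ≤ δ := by
    have := intervalIntegral.norm_integral_le_of_norm_le_const (a := 0) (b := T)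
      (f := fun s => F s S - F s (-S)) (C := 2 * η) (fun s hs => by
        rw [uIoc_of_le hT] at hs
        obtain ⟨h1, h2⟩ := hFb s (Ioc_subset_Icc_self hs)
        rw [Real.norm_eq_abs]
        calc _ ≤ |F s S| + |F s (-S)| := abs_sub _ _
          _ ≤ _ := by linarith)
    rw [sub_zero, abs_of_nonneg hT, Real.norm_eq_abs] at this
    linarith [neg_le_abs (∫ s in (0 : ℝ)..T, (F s S - F s (-S)))]
  have key := box_balance hT hS0.le he hF ce ce' cF' bal
  have hRS : R ≤ S := le_max_left _ _
  have m1 : (∫ x in -R..R, e T x) ≤ ∫ x in -S..S, e T x :=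
    intervalIntegral.integral_mono_interval (by linarith) (by linarith) hRS
      (Eventually.of_forall fun x => epos T x) ((slice ce T).intervalIntegrable _ _)
  have m2 : (∫ s in (0 : ℝ)..T, ∫ x in -R..R, Q s x)
      ≤ ∫ s in (0 : ℝ)..T, ∫ x in -S..S, Q s x := by
    rw [intervalIntegral.integral_of_le hT, intervalIntegral.integral_of_le hT]
    refine setIntegral_mono_on (par R cQ).1 (par S cQ).1 measurableSet_Ioc fun s hs => ?_
    exact intervalIntegral.integral_mono_interval (by linarith) (by linarith) hRS
      (Eventually.of_forall fun x => Qpos s hs x) ((slice cQ s).intervalIntegrable _ _)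
  linarith [e0 S hS0]

end Box

section Limits

/-- One-dimensional Sobolev inequality, with the `H¹` norm controlled on bounded intervals. -/
theorem mul_sq_le_of_integral_le {f f' : ℝ → ℝ} {c K : ℝ}
    (hf : ∀ x, HasDerivAt f (f' x) x) (cf' : Continuous f')
    (hlim : Tendsto f (cocompact ℝ) (nhds 0))
    (hK : ∀ R > 0, ∫ x in -R..R, ((f x) ^ 2 + c ^ 2 * (f' x) ^ 2) ≤ K) (x : ℝ) :
    c * (f x) ^ 2 ≤ K := by
  have cf : Continuous f := continuous_iff_continuousAt.2 fun x => (hf x).continuousAt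
  have hbot : Tendsto (fun R : ℝ => c * (f (-R)) ^ 2 + K) atTop (nhds (c * 0 ^ 2 + K)) := by
    have h1 : Tendsto (fun R : ℝ => f (-R)) atTop (nhds 0) :=
      (hlim.mono_left atBot_le_cocompact).comp tendsto_neg_atTop_atBot
    exact ((h1.pow 2).const_mul c).add_const K
  have hle : ∀ᶠ R : ℝ in atTop, c * (f x) ^ 2 ≤ c * (f (-R)) ^ 2 + K := by
    filter_upwards [eventually_gt_atTop |x|] with R hR
    have hx := abs_lt.1 hR
    have hR0 : 0 < R := (abs_nonneg x).trans_lt hR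
    have c1 : Continuous fun y => 2 * c * f y * f' y := by fun_prop
    have c2 : Continuous fun y => (f y) ^ 2 + c ^ 2 * (f' y) ^ 2 := by fun_prop
    have e1 : ∫ y in -R..x, 2 * c * f y * f' y = c * (f x) ^ 2 - c * (f (-R)) ^ 2 := by
      refine intervalIntegral.integral_eq_sub_of_hasDerivAt
        (f := fun y => c * (f y) ^ 2) (fun y _ => ?_) (c1.intervalIntegrable _ _)
      exact (((hf y).fun_pow 2).const_mul c).congr_deriv (by push_cast; ring)
    have e2 : ∫ y in -R..x, 2 * c * f y * f' y
        ≤ ∫ y in -R..x, ((f y) ^ 2 + c ^ 2 * (f' y) ^ 2) :=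
      intervalIntegral.integral_mono_on (by linarith) (c1.intervalIntegrable _ _)
        (c2.intervalIntegrable _ _) fun y _ => by nlinarith [sq_nonneg (f y - c * f' y)]
    have e3 : ∫ y in -R..x, ((f y) ^ 2 + c ^ 2 * (f' y) ^ 2)
        ≤ ∫ y in -R..R, ((f y) ^ 2 + c ^ 2 * (f' y) ^ 2) :=
      intervalIntegral.integral_mono_interval le_rfl (by linarith) (by linarith)
        (Eventually.of_forall fun y => by positivity) (c2.intervalIntegrable _ _)
    linarith [hK R hR0]
  simpa using ge_of_tendsto hbot hle

theorem integral_box_le_integral {f : ℝ → ℝ} (hf : Integrable f) (h0 : ∀ x, 0 ≤ f x) {R : ℝ}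
    (hR : 0 < R) : ∫ x in -R..R, f x ≤ ∫ x, f x := by
  rw [intervalIntegral.integral_of_le (by linarith)]
  exact setIntegral_le_integral hf (Eventually.of_forall h0)

/-- Bounds on boxes pass to the whole space-time strip. -/
theorem mul_integral_sqL2_le {g Q : ℝ → ℝ → ℝ} {T K κ : ℝ} (hT : 0 ≤ T)
    (cg : Continuous (Function.uncurry g)) (cQ : Continuous (Function.uncurry Q))
    (hg : ∀ s ∈ Ioc 0 T, Integrable fun x => (g s x) ^ 2)
    (hgQ : ∀ s ∈ Ioc 0 T, ∀ x, κ * (g s x) ^ 2 ≤ Q s x) (hK : 0 ≤ K)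
    (hQ : ∀ R > 0, ∫ s in (0 : ℝ)..T, ∫ x in -R..R, Q s x ≤ K) :
    κ * ∫ s in (0 : ℝ)..T, sqL2 (g s) ≤ K := by
  by_cases hi : IntervalIntegrable (fun s => sqL2 (g s)) volume 0 T
  swap
  · rw [intervalIntegral.integral_undef hi]
    simpa using hK
  have cg2 : Continuous (Function.uncurry fun s x => (g s x) ^ 2) := by
    have := cg.pow 2
    exact this
  have par : ∀ {h : ℝ → ℝ → ℝ} (R : ℝ), Continuous (Function.uncurry h) →
      Continuous (fun s => ∫ x in -R..R, h s x) := fun R hh =>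
    intervalIntegral.continuous_parametric_intervalIntegral_of_continuous' hh _ _
  have slice : ∀ {h : ℝ → ℝ → ℝ}, Continuous (Function.uncurry h) → ∀ s, Continuous (h s) :=
    fun hh s => hh.comp (continuous_const.prodMk continuous_id)
  have hlim : Tendsto (fun R : ℝ => κ * ∫ s in (0 : ℝ)..T, ∫ x in -R..R, (g s x) ^ 2) atTop
      (nhds (κ * ∫ s in (0 : ℝ)..T, sqL2 (g s))) := by
    refine Tendsto.const_mul κ ?_
    refine intervalIntegral.tendsto_integral_filter_of_dominated_convergence
      (fun s => sqL2 (g s)) ?_ ?_ hi ?_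
    · exact Eventually.of_forall fun R => (par R cg2).aestronglyMeasurable
    · filter_upwards [eventually_gt_atTop 0] with R hR
      refine Eventually.of_forall fun s hs => ?_
      rw [uIoc_of_le hT] at hs
      rw [Real.norm_of_nonneg
        (intervalIntegral.integral_nonneg (by linarith) fun x _ => sq_nonneg _)]
      exact integral_box_le_integral (hg s hs) (fun x => sq_nonneg _) hR
    · refine Eventually.of_forall fun s hs => ?_
      rw [uIoc_of_le hT] at hs
      exact intervalIntegral_tendsto_integral (hg s hs) tendsto_neg_atTop_atBot tendsto_id
  refine le_of_tendsto hlim ?_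
  filter_upwards [eventually_gt_atTop 0] with R hR
  refine le_trans ?_ (hQ R hR)
  rw [← intervalIntegral.integral_const_mul, intervalIntegral.integral_of_le hT,
    intervalIntegral.integral_of_le hT]
  refine setIntegral_mono_on (((par R cg2).const_mul κ).intervalIntegrable 0 T).1
    ((par R cQ).intervalIntegrable 0 T).1 measurableSet_Ioc fun s hs => ?_
  rw [← intervalIntegral.integral_const_mul]
  exact intervalIntegral.integral_mono_on (by linarith)
    (((slice cg2 s).const_mul κ).intervalIntegrable _ _) ((slice cQ s).intervalIntegrable _ _)
    fun x _ => hgQ s hs x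

end Limits

section Algebra

theorem quadratic_form_nonneg {p q w : ℝ} (hp : 0 < p) (h : w ^ 2 ≤ 4 * p * q) (a c : ℝ) :
    0 ≤ p * a ^ 2 + w * a * c + q * c ^ 2 := by
  have h1 : 0 ≤ 4 * p * (p * a ^ 2 + w * a * c + q * c ^ 2) := by
    have : 4 * p * (p * a ^ 2 + w * a * c + q * c ^ 2)
        = (2 * p * a + w * c) ^ 2 + (4 * p * q - w ^ 2) * c ^ 2 := by ring
    rw [this]
    have := mul_nonneg (sub_nonneg.2 h) (sq_nonneg c)
    positivity
  exact nonneg_of_mul_nonneg_right h1 (by positivity)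

/-- Coercivity of the total dissipation density. -/
theorem dissipation_coercive {ε β u u1 u2 u3 v1 v2 v3 : ℝ} (hε : 0 < ε) (hβ : 0 < β)
    (hu : 100 * (β * u ^ 2) ≤ ε ^ 2) (hu1 : 100 * (β * u1) ^ 2 ≤ ε ^ 2) :
    1 / 32 * (β * ε * v1 ^ 2 + β ^ 2 * ε * v2 ^ 2 + β ^ 3 * ε * v3 ^ 2 + β ^ 2 * ε * u3 ^ 2
        + ε * (u * u1) ^ 2 + ε ^ 3 * u2 ^ 2)
      ≤ (ε * u1 ^ 2 + ε * β ^ 2 * u3 ^ 2 + β * ε * u2 ^ 2 + β * ε * (u1 * u3)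
          + 5 * β ^ 2 * (u1 * u2 ^ 2))
        + (3 * ε * (u * u1) ^ 2 - 3 * β * (u ^ 2 * u1 * u2) + 3 * β * (u ^ 2 * u1 * v1)
          - 3 * β ^ 2 * (u ^ 2 * u1 * v3))
        + 1 / 8 * (β * ε) * (v1 ^ 2 - 2 * (u * u1 * v2) - β * (u3 * v2) + β * v2 ^ 2
          + β ^ 2 * v3 ^ 2)
        + 1 / 4 * ε ^ 2 * (ε * u2 ^ 2 - 2 * (u * u1 * u2)) := by
  have i1 : 0 ≤ 1 / 2 * ε * (u1 + β * u3) ^ 2 := by positivity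
  have i2 : 0 ≤ β * (1 / 2 * ε + 5 * (β * u1)) * u2 ^ 2 := by
    have : |β * u1| ≤ ε / 10 := abs_le_of_sq_le_sq (by nlinarith) (by positivity)
    have := (abs_le.1 this).1
    have : 0 ≤ 1 / 2 * ε + 5 * (β * u1) := by linarith
    positivity
  have i3 := quadratic_form_nonneg (p := 1 / 2 * ε) (q := 9 / 200 * (β * ε)) (w := -3 * β * u)
    (by positivity) (by nlinarith [mul_le_mul_of_nonneg_left hu hβ.le]) (u * u1) u2
  have i4 := quadratic_form_nonneg (p := 2 / 5 * ε) (q := 1 / 16 * (β * ε)) (w := 3 * β * u)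
    (by positivity)
    (by nlinarith [mul_le_mul_of_nonneg_left hu hβ.le, mul_pos hβ (pow_pos hε 2)]) (u * u1) v1
  have i5 := quadratic_form_nonneg (p := 2 / 5 * ε) (q := 1 / 16 * (β ^ 3 * ε))
    (w := -3 * β ^ 2 * u) (by positivity)
    (by nlinarith [mul_le_mul_of_nonneg_left hu (pow_pos hβ 3).le,
      mul_pos (pow_pos hβ 3) (pow_pos hε 2)]) (u * u1) v3
  have i6 := quadratic_form_nonneg (p := 1 / 2 * ε) (q := 1 / 32 * (β ^ 2 * ε))
    (w := -1 / 4 * (β * ε)) (by positivity) (le_of_eq (by ring)) (u * u1) v2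
  have i7 := quadratic_form_nonneg (p := 1 / 8 * (β ^ 2 * ε)) (q := 1 / 32 * (β ^ 2 * ε))
    (w := -1 / 8 * (β ^ 2 * ε)) (by positivity) (le_of_eq (by ring)) u3 v2
  have i8 := quadratic_form_nonneg (p := 1 / 2 * ε) (q := 1 / 8 * ε ^ 3)
    (w := -1 / 2 * ε ^ 2) (by positivity) (le_of_eq (by ring)) (u * u1) u2
  have p1 : 0 ≤ β * ε * v1 ^ 2 := by positivity
  have p2 : 0 ≤ β ^ 2 * ε * v2 ^ 2 := by positivity
  have p3 : 0 ≤ β ^ 3 * ε * v3 ^ 2 := by positivity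
  have p4 : 0 ≤ β ^ 2 * ε * u3 ^ 2 := by positivity
  have p5 : 0 ≤ ε * (u * u1) ^ 2 := by positivity
  have p6 : 0 ≤ ε ^ 3 * u2 ^ 2 := by positivity
  have p7 : 0 ≤ β * ε * u2 ^ 2 := by positivity
  have p8 : 0 ≤ ε * u1 ^ 2 := by positivity
  linarith

end Algebra

section Decay

variable {l : Filter (ℝ × ℝ)} {f g : ℝ × ℝ → ℝ}

theorem tendsto_zero_add (hf : Tendsto f l (nhds 0)) (hg : Tendsto g l (nhds 0)) :
    Tendsto (fun p => f p + g p) l (nhds 0) := by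
  simpa using hf.add hg

theorem tendsto_zero_sub (hf : Tendsto f l (nhds 0)) (hg : Tendsto g l (nhds 0)) :
    Tendsto (fun p => f p - g p) l (nhds 0) := by
  simpa using hf.sub hg

theorem tendsto_zero_mul (hf : Tendsto f l (nhds 0)) (hg : Tendsto g l (nhds 0)) :
    Tendsto (fun p => f p * g p) l (nhds 0) := by
  simpa using hf.mul hg

theorem tendsto_zero_const_mul (c : ℝ) (hf : Tendsto f l (nhds 0)) :
    Tendsto (fun p => c * f p) l (nhds 0) := by
  simpa using hf.const_mul c

end Decay

namespace IsAdmissibleKdVRLW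

variable {ε β : ℝ} {u : ℝ → ℝ → ℝ}

theorem tendsto_mixedD (hu : IsAdmissibleKdVRLW ε β u) {T : ℝ} (hT : 0 < T) {j k : ℕ}
    (h : j + k ≤ 5) :
    Tendsto (fun p : ℝ × ℝ => mixedD u j k p.1 p.2) (𝓟 (Icc 0 T) ×ˢ cocompact ℝ) (nhds 0) := by
  rw [Metric.tendsto_nhds]
  intro δ hδ
  obtain ⟨M, hM⟩ := hu.decay T hT j k h (δ / 2) (by positivity)
  have h1 : ∀ᶠ t in 𝓟 (Icc 0 T), t ∈ Icc 0 T := mem_principal_self _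
  have h2 : ∀ᶠ x : ℝ in cocompact ℝ, M ≤ |x| :=
    tendsto_norm_cocompact_atTop.eventually (eventually_ge_atTop M)
  filter_upwards [h1.prod_mk h2] with p hp
  rw [Real.dist_eq, sub_zero]
  linarith [hM p.2 hp.2 p.1 hp.1]

theorem contDiff_uncurry (hu : IsAdmissibleKdVRLW ε β u) :
    ContDiff ℝ (⊤ : ℕ∞) (Function.uncurry u) := hu.smooth

theorem continuous_mixedD (hu : IsAdmissibleKdVRLW ε β u) (j k : ℕ) :
    Continuous fun p : ℝ × ℝ => mixedD u j k p.1 p.2 :=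
  (contDiff_mixedD hu.contDiff_uncurry j k).continuous

theorem continuous_mixedD_right (hu : IsAdmissibleKdVRLW ε β u) (j k : ℕ) (t : ℝ) :
    Continuous (mixedD u j k t) :=
  (hu.continuous_mixedD j k).comp (continuous_const.prodMk continuous_id)

theorem residual_eq_zero (hu : IsAdmissibleKdVRLW ε β u) {t : ℝ} (ht : 0 < t) (x : ℝ) :
    mixedD u 1 0 t x + 2 * mixedD u 0 0 t x * mixedD u 0 1 t x + β * mixedD u 0 3 t x
      - β * mixedD u 1 2 t x + β ^ 2 * mixedD u 1 4 t x - ε * mixedD u 0 2 t x = 0 := by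
  have h := hu.pde t ht x
  have hd : deriv (fun y => (u t y) ^ 2) x = 2 * mixedD u 0 0 t x * mixedD u 0 1 t x := by
    have := ((hasDerivAt_mixedD_snd hu.contDiff_uncurry 0 0 t x).fun_pow 2).deriv
    simp only [mixedD_zero_zero] at this ⊢
    rw [this]
    ring
  rw [hd] at h
  linarith

/-- The basic energy estimate. -/
theorem energy_le (hu : IsAdmissibleKdVRLW ε β u) (hε : 0 < ε) (hβ : 0 < β) {K T R : ℝ}
    (hT : 0 < T) (hR : 0 < R)
    (h0 : ∀ R > 0, ∫ x in -R..R, (mixedD u 0 0 0 x ^ 2 + β * mixedD u 0 1 0 x ^ 2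
      + β ^ 2 * mixedD u 0 2 0 x ^ 2) ≤ K) :
    ∫ x in -R..R, (mixedD u 0 0 T x ^ 2 + β * mixedD u 0 1 T x ^ 2
      + β ^ 2 * mixedD u 0 2 T x ^ 2) ≤ K := by
  have hx := hasDerivAt_mixedD_snd hu.contDiff_uncurry
  have ht := hasDerivAt_mixedD_fst hu.contDiff_uncurry
  have cU := hu.continuous_mixedD
  have dU : ∀ {j k : ℕ}, j + k ≤ 5 → Tendsto (fun p : ℝ × ℝ => mixedD u j k p.1 p.2)
      (𝓟 (Icc 0 T) ×ˢ cocompact ℝ) (nhds 0) := hu.tendsto_mixedD hT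
  have key := box_energy_le (K := K) hT.le
    (e := fun t x => mixedD u 0 0 t x ^ 2 + β * mixedD u 0 1 t x ^ 2
      + β ^ 2 * mixedD u 0 2 t x ^ 2)
    (e' := fun t x => 2 * (mixedD u 0 0 t x * mixedD u 1 0 t x)
      + 2 * β * (mixedD u 0 1 t x * mixedD u 1 1 t x)
      + 2 * β ^ 2 * (mixedD u 0 2 t x * mixedD u 1 2 t x))
    (F := fun t x => 4 / 3 * (mixedD u 0 0 t x * mixedD u 0 0 t x * mixedD u 0 0 t x)
      + 2 * β * (mixedD u 0 0 t x * mixedD u 0 2 t x)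
      - β * (mixedD u 0 1 t x * mixedD u 0 1 t x) - 2 * β * (mixedD u 0 0 t x * mixedD u 1 1 t x)
      + 2 * β ^ 2 * (mixedD u 0 0 t x * mixedD u 1 3 t x)
      - 2 * β ^ 2 * (mixedD u 0 1 t x * mixedD u 1 2 t x)
      - 2 * ε * (mixedD u 0 0 t x * mixedD u 0 1 t x))
    (F' := fun t x => 2 * mixedD u 0 0 t x * (mixedD u 1 0 t x
        + 2 * mixedD u 0 0 t x * mixedD u 0 1 t x + β * mixedD u 0 3 t x
        - β * mixedD u 1 2 t x + β ^ 2 * mixedD u 1 4 t x - ε * mixedD u 0 2 t x)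
      - (2 * (mixedD u 0 0 t x * mixedD u 1 0 t x)
        + 2 * β * (mixedD u 0 1 t x * mixedD u 1 1 t x)
        + 2 * β ^ 2 * (mixedD u 0 2 t x * mixedD u 1 2 t x))
      - 2 * ε * mixedD u 0 1 t x ^ 2)
    (Q := fun t x => 2 * ε * mixedD u 0 1 t x ^ 2)
    ?_ ?_ ?_ ?_ ?_ ?_ ?_ ?_ h0 ?_ ?_ hR
  · have : 0 ≤ ∫ s in (0 : ℝ)..T, ∫ x in -R..R, 2 * ε * mixedD u 0 1 s x ^ 2 :=
      intervalIntegral.integral_nonneg hT.le fun s _ =>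
        intervalIntegral.integral_nonneg (by linarith) fun x _ => by positivity
    linarith
  · intro t x
    refine HasDerivAt.congr_deriv (((ht 0 0 t x).fun_pow 2).fun_add
      (((ht 0 1 t x).fun_pow 2).const_mul β) |>.fun_add
      (((ht 0 2 t x).fun_pow 2).const_mul (β ^ 2))) ?_
    norm_num
    ring
  · intro t x
    have h (j k : ℕ) := hx j k t x
    refine HasDerivAt.congr_deriv
      ((((((((((h 0 0).fun_mul (h 0 0)).fun_mul (h 0 0)).const_mul (4 / 3)).fun_add
      (((h 0 0).fun_mul (h 0 2)).const_mul (2 * β))).fun_sub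
      (((h 0 1).fun_mul (h 0 1)).const_mul β)).fun_sub
      (((h 0 0).fun_mul (h 1 1)).const_mul (2 * β))).fun_add
      (((h 0 0).fun_mul (h 1 3)).const_mul (2 * β ^ 2))).fun_sub
      (((h 0 1).fun_mul (h 1 2)).const_mul (2 * β ^ 2))).fun_sub
      (((h 0 0).fun_mul (h 0 1)).const_mul (2 * ε))) ?_
    norm_num
    ring
  · simp only [Function.uncurry_def]; fun_prop
  · simp only [Function.uncurry_def]; fun_prop
  · simp only [Function.uncurry_def]; fun_prop
  · simp only [Function.uncurry_def]; fun_prop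
  · intro t ht0 x
    have := hu.residual_eq_zero ht0 x
    rw [this]
    ring
  · simp only [Function.uncurry_def]
    generalize mixedD u = U at dU ⊢
    repeat' first
      | exact dU (by norm_num)
      | refine tendsto_zero_sub ?_ ?_
      | refine tendsto_zero_add ?_ ?_
      | refine tendsto_zero_const_mul _ ?_
      | refine tendsto_zero_mul ?_ ?_
  · intro t x; positivity
  · intro t _ x; positivity

end IsAdmissibleKdVRLW

section TotalEnergy

/-- Energy density of the multiplier `u + β² uₓₓₓₓ + u³ - (βε/8) uₜₓₓ - (ε²/4) uₓₓ`. -/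
def totalEnergy (ε β u u1 u2 u3 u4 : ℝ) : ℝ :=
  1 / 2 * u ^ 2 + 1 / 2 * β * u1 ^ 2 + β ^ 2 * u2 ^ 2 + 1 / 2 * β ^ 3 * u3 ^ 2
    + 1 / 2 * β ^ 4 * u4 ^ 2 + 1 / 4 * u ^ 4 + 3 / 16 * (β * ε ^ 2) * u2 ^ 2
    + 1 / 8 * ε ^ 2 * u1 ^ 2 + 1 / 8 * (β ^ 2 * ε ^ 2) * u3 ^ 2

/-- Time derivative of `totalEnergy`, `vₖ` being the time derivative of `uₖ`. -/
def totalEnergyRate (ε β u u1 u2 u3 u4 v0 v1 v2 v3 v4 : ℝ) : ℝ :=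
  u * v0 + β * u1 * v1 + 2 * β ^ 2 * u2 * v2 + β ^ 3 * u3 * v3
    + β ^ 4 * u4 * v4 + u ^ 3 * v0 + 3 / 8 * (β * ε ^ 2) * u2 * v2
    + 1 / 4 * ε ^ 2 * u1 * v1 + 1 / 4 * (β ^ 2 * ε ^ 2) * u3 * v3

/-- Flux associated with `totalEnergy`. -/
def totalFlux (ε β u u1 u2 u3 v0 v1 v2 v3 : ℝ) : ℝ :=
  2 / 3 * u ^ 3 + β * (u * u2) + (-1 / 2 * β) * u1 ^ 2 + (-β) * (u * v1) + β ^ 2 * (u * v3)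
    + (-β ^ 2) * (u1 * v2) + (-ε) * (u * u1) + β ^ 2 * (u3 * v0) + (-β ^ 2) * (u2 * v1)
    + (2 * β ^ 2) * (u * u1 * u3) + (-β ^ 2) * (u * u2 ^ 2) + (-2 * β ^ 2) * (u1 ^ 2 * u2)
    + (1 / 2 * β ^ 3) * u3 ^ 2 + (-β ^ 3) * (u3 * v2) + (-ε * β ^ 2) * (u3 * u2)
    + (-β * ε) * (u1 * u2) + 2 / 5 * u ^ 5 + β * (u ^ 3 * u2) + (-β) * (u ^ 3 * v1)
    + β ^ 2 * (u ^ 3 * v3) + (-ε) * (u ^ 3 * u1) + (-1 / 8 * (β * ε)) * (v0 * v1)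
    + (-1 / 8 * (β ^ 3 * ε)) * (v2 * v3) + (-1 / 4 * ε ^ 2) * (u1 * v0)
    + (-1 / 8 * (ε ^ 2 * β)) * u2 ^ 2 + (-1 / 4 * (ε ^ 2 * β ^ 2)) * (u2 * v3)

/-- Dissipation density associated with `totalEnergy`. -/
def totalDissipation (ε β u u1 u2 u3 v1 v2 v3 : ℝ) : ℝ :=
  (ε * u1 ^ 2 + ε * β ^ 2 * u3 ^ 2 + β * ε * u2 ^ 2 + β * ε * (u1 * u3)
      + 5 * β ^ 2 * (u1 * u2 ^ 2))
    + (3 * ε * (u * u1) ^ 2 - 3 * β * (u ^ 2 * u1 * u2) + 3 * β * (u ^ 2 * u1 * v1)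
      - 3 * β ^ 2 * (u ^ 2 * u1 * v3))
    + 1 / 8 * (β * ε) * (v1 ^ 2 - 2 * (u * u1 * v2) - β * (u3 * v2) + β * v2 ^ 2
      + β ^ 2 * v3 ^ 2)
    + 1 / 4 * ε ^ 2 * (ε * u2 ^ 2 - 2 * (u * u1 * u2))

/-- Space derivative of `totalFlux`. -/
def totalFluxDeriv (ε β u u1 u2 u3 u4 v0 v1 v2 v3 v4 : ℝ) : ℝ :=
  (u + β ^ 2 * u4 + u ^ 3 - 1 / 8 * (β * ε) * v2 - 1 / 4 * ε ^ 2 * u2)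
      * (v0 + 2 * u * u1 + β * u3 - β * v2 + β ^ 2 * v4 - ε * u2)
    - totalEnergyRate ε β u u1 u2 u3 u4 v0 v1 v2 v3 v4
    - totalDissipation ε β u u1 u2 u3 v1 v2 v3

theorem hasDerivAt_totalEnergy (ε β : ℝ) {u u1 u2 u3 u4 : ℝ → ℝ} {v0 v1 v2 v3 v4 t : ℝ}
    (hu : HasDerivAt u v0 t) (hu1 : HasDerivAt u1 v1 t) (hu2 : HasDerivAt u2 v2 t)
    (hu3 : HasDerivAt u3 v3 t) (hu4 : HasDerivAt u4 v4 t) :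
    HasDerivAt (fun s => totalEnergy ε β (u s) (u1 s) (u2 s) (u3 s) (u4 s))
      (totalEnergyRate ε β (u t) (u1 t) (u2 t) (u3 t) (u4 t) v0 v1 v2 v3 v4) t := by
  refine HasDerivAt.congr_deriv ((hu.fun_pow 2).const_mul (1 / 2)
    |>.fun_add ((hu1.fun_pow 2).const_mul (1 / 2 * β))
    |>.fun_add ((hu2.fun_pow 2).const_mul (β ^ 2))
    |>.fun_add ((hu3.fun_pow 2).const_mul (1 / 2 * β ^ 3))
    |>.fun_add ((hu4.fun_pow 2).const_mul (1 / 2 * β ^ 4))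
    |>.fun_add ((hu.fun_pow 4).const_mul (1 / 4))
    |>.fun_add ((hu2.fun_pow 2).const_mul (3 / 16 * (β * ε ^ 2)))
    |>.fun_add ((hu1.fun_pow 2).const_mul (1 / 8 * ε ^ 2))
    |>.fun_add ((hu3.fun_pow 2).const_mul (1 / 8 * (β ^ 2 * ε ^ 2)))) ?_
  simp only [totalEnergyRate]
  norm_num
  ring

theorem hasDerivAt_totalFlux (ε β : ℝ) {u u1 u2 u3 v0 v1 v2 v3 : ℝ → ℝ} {u4 v4 x : ℝ}
    (hu : HasDerivAt u (u1 x) x) (hu1 : HasDerivAt u1 (u2 x) x)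
    (hu2 : HasDerivAt u2 (u3 x) x) (hu3 : HasDerivAt u3 u4 x)
    (hv0 : HasDerivAt v0 (v1 x) x) (hv1 : HasDerivAt v1 (v2 x) x)
    (hv2 : HasDerivAt v2 (v3 x) x) (hv3 : HasDerivAt v3 v4 x) :
    HasDerivAt
      (fun y => totalFlux ε β (u y) (u1 y) (u2 y) (u3 y) (v0 y) (v1 y) (v2 y) (v3 y))
      (totalFluxDeriv ε β (u x) (u1 x) (u2 x) (u3 x) u4 (v0 x) (v1 x) (v2 x) (v3 x) v4) x := by
  refine HasDerivAt.congr_deriv (((hu.fun_pow 3).const_mul (2 / 3))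
    |>.fun_add ((hu.fun_mul hu2).const_mul β)
    |>.fun_add ((hu1.fun_pow 2).const_mul (-1 / 2 * β))
    |>.fun_add ((hu.fun_mul hv1).const_mul (-β))
    |>.fun_add ((hu.fun_mul hv3).const_mul (β ^ 2))
    |>.fun_add ((hu1.fun_mul hv2).const_mul (-β ^ 2))
    |>.fun_add ((hu.fun_mul hu1).const_mul (-ε))
    |>.fun_add ((hu3.fun_mul hv0).const_mul (β ^ 2))
    |>.fun_add ((hu2.fun_mul hv1).const_mul (-β ^ 2))
    |>.fun_add (((hu.fun_mul hu1).fun_mul hu3).const_mul (2 * β ^ 2))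
    |>.fun_add ((hu.fun_mul (hu2.fun_pow 2)).const_mul (-β ^ 2))
    |>.fun_add (((hu1.fun_pow 2).fun_mul hu2).const_mul (-2 * β ^ 2))
    |>.fun_add ((hu3.fun_pow 2).const_mul (1 / 2 * β ^ 3))
    |>.fun_add ((hu3.fun_mul hv2).const_mul (-β ^ 3))
    |>.fun_add ((hu3.fun_mul hu2).const_mul (-ε * β ^ 2))
    |>.fun_add ((hu1.fun_mul hu2).const_mul (-β * ε))
    |>.fun_add ((hu.fun_pow 5).const_mul (2 / 5))
    |>.fun_add (((hu.fun_pow 3).fun_mul hu2).const_mul β)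
    |>.fun_add (((hu.fun_pow 3).fun_mul hv1).const_mul (-β))
    |>.fun_add (((hu.fun_pow 3).fun_mul hv3).const_mul (β ^ 2))
    |>.fun_add (((hu.fun_pow 3).fun_mul hu1).const_mul (-ε))
    |>.fun_add ((hv0.fun_mul hv1).const_mul (-1 / 8 * (β * ε)))
    |>.fun_add ((hv2.fun_mul hv3).const_mul (-1 / 8 * (β ^ 3 * ε)))
    |>.fun_add ((hu1.fun_mul hv0).const_mul (-1 / 4 * ε ^ 2))
    |>.fun_add ((hu2.fun_pow 2).const_mul (-1 / 8 * (ε ^ 2 * β)))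
    |>.fun_add ((hu2.fun_mul hv3).const_mul (-1 / 4 * (ε ^ 2 * β ^ 2)))) ?_
  simp only [totalFluxDeriv, totalEnergyRate, totalDissipation]
  norm_num
  ring

theorem tendsto_totalFlux (ε β : ℝ) {l : Filter (ℝ × ℝ)} {u u1 u2 u3 v0 v1 v2 v3 : ℝ × ℝ → ℝ}
    (hu : Tendsto u l (nhds 0)) (hu1 : Tendsto u1 l (nhds 0)) (hu2 : Tendsto u2 l (nhds 0))
    (hu3 : Tendsto u3 l (nhds 0)) (hv0 : Tendsto v0 l (nhds 0)) (hv1 : Tendsto v1 l (nhds 0))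
    (hv2 : Tendsto v2 l (nhds 0)) (hv3 : Tendsto v3 l (nhds 0)) :
    Tendsto (fun p => totalFlux ε β (u p) (u1 p) (u2 p) (u3 p) (v0 p) (v1 p) (v2 p) (v3 p)) l
      (nhds 0) := by
  have hc : Continuous fun q : ℝ × ℝ × ℝ × ℝ × ℝ × ℝ × ℝ × ℝ => totalFlux ε β q.1 q.2.1 q.2.2.1
      q.2.2.2.1 q.2.2.2.2.1 q.2.2.2.2.2.1 q.2.2.2.2.2.2.1 q.2.2.2.2.2.2.2 := by
    unfold totalFlux
    fun_prop
  have h0 := hu.prodMk_nhds (hu1.prodMk_nhds (hu2.prodMk_nhds (hu3.prodMk_nhds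
    (hv0.prodMk_nhds (hv1.prodMk_nhds (hv2.prodMk_nhds hv3))))))
  have := (hc.tendsto _).comp h0
  have hz : totalFlux ε β 0 0 0 0 0 0 0 0 = 0 := by simp [totalFlux]
  rwa [hz] at this

end TotalEnergy

section BoxBounds

variable {f g : ℝ → ℝ} {R A B : ℝ}

theorem box_bound_add (hf : Continuous f ∧ ∫ x in -R..R, f x ≤ A)
    (hg : Continuous g ∧ ∫ x in -R..R, g x ≤ B) :
    Continuous (fun x => f x + g x) ∧ ∫ x in -R..R, (f x + g x) ≤ A + B := by
  refine ⟨hf.1.add hg.1, ?_⟩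
  rw [intervalIntegral.integral_add (hf.1.intervalIntegrable _ _) (hg.1.intervalIntegrable _ _)]
  exact add_le_add hf.2 hg.2

theorem box_bound_const_mul {c : ℝ} (hc : 0 ≤ c) (hf : Continuous f ∧ ∫ x in -R..R, f x ≤ A) :
    Continuous (fun x => c * f x) ∧ ∫ x in -R..R, c * f x ≤ c * A := by
  refine ⟨hf.1.const_mul c, ?_⟩
  rw [intervalIntegral.integral_const_mul]
  exact mul_le_mul_of_nonneg_left hf.2 hc

end BoxBounds

namespace IsAdmissibleKdVRLW

variable {ε β C0 : ℝ} {u : ℝ → ℝ → ℝ}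

theorem tendsto_mixedD_right (hu : IsAdmissibleKdVRLW ε β u) {t : ℝ} (ht : 0 ≤ t) {j k : ℕ}
    (h : j + k ≤ 5) : Tendsto (mixedD u j k t) (cocompact ℝ) (nhds 0) := by
  rw [Metric.tendsto_nhds]
  intro δ hδ
  obtain ⟨M, hM⟩ := hu.decay (t + 1) (by linarith) j k h (δ / 2) (by positivity)
  filter_upwards [tendsto_norm_cocompact_atTop.eventually (eventually_ge_atTop M)] with x hx
  rw [Real.dist_eq, sub_zero]
  linarith [hM x hx t ⟨ht, by linarith⟩]

theorem integrable_sq_mul (hu : IsAdmissibleKdVRLW ε β u) {t : ℝ} (ht : 0 ≤ t) {k : ℕ}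
    (hk : k ≤ 5) : Integrable fun x => (mixedD u 0 0 t x * mixedD u 0 k t x) ^ 2 := by
  have c0 := hu.continuous_mixedD_right 0 0 t
  obtain ⟨M, hM⟩ := ZeroAtInftyContinuousMap.bounded
    (⟨⟨mixedD u 0 0 t, c0⟩, hu.tendsto_mixedD_right ht (by norm_num)⟩ :
      ZeroAtInftyContinuousMap ℝ ℝ)
  have hM' : ∀ x, |mixedD u 0 0 t x| ≤ |mixedD u 0 0 t 0| + M := fun x => by
    have h1 : |mixedD u 0 0 t x - mixedD u 0 0 t 0| ≤ M := hM x 0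
    linarith [abs_sub_abs_le_abs_sub (mixedD u 0 0 t x) (mixedD u 0 0 t 0)]
  have hi := hu.sq_int (t + 1) (by linarith) 0 k (by omega) t ⟨ht, by linarith⟩
  have hm : Integrable fun x => (mixedD u 0 0 t x) ^ 2 * (mixedD u 0 k t x) ^ 2 := by
    refine hi.bdd_mul (c := (|mixedD u 0 0 t 0| + M) ^ 2) (c0.pow 2).aestronglyMeasurable
      (Eventually.of_forall fun x => ?_)
    rw [norm_pow, Real.norm_eq_abs]
    exact pow_le_pow_left₀ (abs_nonneg _) (hM' x) 2
  simpa only [mul_pow] using hm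

theorem initial_le (hu : IsAdmissibleKdVRLW ε β u) (hε : 0 < ε) (hβ : 0 < β)
    (hd : DataBoundsKdVRLW ε β C0 (u 0)) {R : ℝ} (hR : 0 < R) :
    ∫ x in -R..R, (mixedD u 0 0 0 x ^ 2 + β * mixedD u 0 1 0 x ^ 2
      + β ^ 2 * mixedD u 0 2 0 x ^ 2) ≤ 2 * C0 ∧
    ∫ x in -R..R, totalEnergy ε β (mixedD u 0 0 0 x) (mixedD u 0 1 0 x) (mixedD u 0 2 0 x)
      (mixedD u 0 3 0 x) (mixedD u 0 4 0 x) ≤ 3 * C0 := by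
  have hder : ∀ k x, iteratedDeriv k (u 0) x = mixedD u 0 k 0 x := fun k x => by
    simp [mixedD]
  have hder0 : ∀ x, u 0 x = mixedD u 0 0 0 x := fun x => by simp [mixedD]
  have hder1 : ∀ x, deriv (u 0) x = mixedD u 0 1 0 x := fun x => by
    rw [← hder, iteratedDeriv_one]
  obtain ⟨d1, d2, d3⟩ := hd
  simp only [hder, hder0, hder1] at d1 d2 d3
  have c := fun k => hu.continuous_mixedD_right 0 k 0
  have hi : ∀ k, k ≤ 5 → (Continuous (fun x => mixedD u 0 k 0 x ^ 2) ∧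
      ∫ x in -R..R, mixedD u 0 k 0 x ^ 2 ≤ ∫ x, mixedD u 0 k 0 x ^ 2) := fun k hk =>
    ⟨(c k).pow 2, integral_box_le_integral
      (hu.sq_int 1 one_pos 0 k (by omega) 0 ⟨le_rfl, zero_le_one⟩) (fun x => sq_nonneg _) hR⟩
  have h4 : Continuous (fun x => mixedD u 0 0 0 x ^ 4) ∧
      ∫ x in -R..R, mixedD u 0 0 0 x ^ 4 ≤ ∫ x, mixedD u 0 0 0 x ^ 4 := by
    refine ⟨(c 0).pow 4, integral_box_le_integral ?_ (fun x => by positivity) hR⟩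
    refine (hu.integrable_sq_mul le_rfl (k := 0) (by norm_num)).congr
      (Eventually.of_forall fun x => ?_)
    ring
  have hI : ∀ k, 0 ≤ ∫ x, mixedD u 0 k 0 x ^ 2 := fun k => integral_nonneg fun x => sq_nonneg _
  have hJ : 0 ≤ ∫ x, mixedD u 0 0 0 x ^ 4 := integral_nonneg fun x => by positivity
  have b1 := box_bound_add (box_bound_add (hi 0 (by norm_num))
    (box_bound_const_mul hβ.le (hi 1 (by norm_num))))
    (box_bound_const_mul (sq_nonneg β) (hi 2 (by norm_num)))
  have b2 := box_bound_const_mul (c := 1 / 2) (by norm_num) (hi 0 (by norm_num))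
    |> (box_bound_add · (box_bound_const_mul (c := 1 / 2 * β) (by positivity)
      (hi 1 (by norm_num))))
    |> (box_bound_add · (box_bound_const_mul (c := β ^ 2) (by positivity) (hi 2 (by norm_num))))
    |> (box_bound_add · (box_bound_const_mul (c := 1 / 2 * β ^ 3) (by positivity)
      (hi 3 (by norm_num))))
    |> (box_bound_add · (box_bound_const_mul (c := 1 / 2 * β ^ 4) (by positivity)
      (hi 4 (by norm_num))))
    |> (box_bound_add · (box_bound_const_mul (c := 1 / 4) (by norm_num) h4))
    |> (box_bound_add · (box_bound_const_mul (c := 3 / 16 * (β * ε ^ 2)) (by positivity)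
      (hi 2 (by norm_num))))
    |> (box_bound_add · (box_bound_const_mul (c := 1 / 8 * ε ^ 2) (by positivity)
      (hi 1 (by norm_num))))
    |> (box_bound_add · (box_bound_const_mul (c := 1 / 8 * (β ^ 2 * ε ^ 2)) (by positivity)
      (hi 3 (by norm_num))))
  have n1 := mul_nonneg hβ.le (hI 1)
  have n2 := mul_nonneg (sq_nonneg ε) (hI 1)
  have n3 := mul_nonneg (mul_pos hβ hε).le (hI 2)
  have n4 := mul_nonneg (mul_pos hβ (pow_pos hε 2)).le (hI 2)
  have n5 := mul_nonneg (sq_nonneg β) (hI 2)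
  have n6 := mul_nonneg (mul_pos (pow_pos hβ 2) (pow_pos hε 2)).le (hI 3)
  have n7 := mul_nonneg (pow_pos hβ 3).le (hI 3)
  have n8 := mul_nonneg (pow_pos hβ 4).le (hI 4)
  have n0 := hI 0
  refine ⟨b1.2.trans ?_, ?_⟩
  · linarith
  · simp only [totalEnergy]
    refine b2.2.trans ?_
    linarith

theorem pointwise_le (hu : IsAdmissibleKdVRLW ε β u) (hε : 0 < ε) (hβ : 0 < β)
    (hd : DataBoundsKdVRLW ε β C0 (u 0)) {t : ℝ} (ht : 0 < t) (x : ℝ) :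
    √β * mixedD u 0 0 t x ^ 2 ≤ 2 * C0 ∧ √β * (√β * mixedD u 0 1 t x) ^ 2 ≤ 2 * C0 := by
  have hb : √β ^ 2 = β := Real.sq_sqrt hβ.le
  have hx := fun k => hasDerivAt_mixedD_snd hu.contDiff_uncurry 0 k t
  have c := fun k => hu.continuous_mixedD_right 0 k t
  have hlim := fun k (hk : 0 + k ≤ 5) => hu.tendsto_mixedD_right ht.le hk
  have hE := fun (R : ℝ) (hR : 0 < R) =>
    hu.energy_le hε hβ ht hR fun R hR => (hu.initial_le hε hβ hd hR).1
  have cE : Continuous fun x => mixedD u 0 0 t x ^ 2 + β * mixedD u 0 1 t x ^ 2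
      + β ^ 2 * mixedD u 0 2 t x ^ 2 := by
    fun_prop
  constructor
  · refine mul_sq_le_of_integral_le (f := mixedD u 0 0 t) (f' := mixedD u 0 1 t)
      (hx 0) (c 1) (hlim 0 (by norm_num)) (fun R hR => ?_) x
    refine le_trans (intervalIntegral.integral_mono_on (by linarith)
      (Continuous.intervalIntegrable (by fun_prop) _ _) (cE.intervalIntegrable _ _)
      fun x _ => ?_) (hE R hR)
    rw [hb]
    linarith [mul_nonneg (sq_nonneg β) (sq_nonneg (mixedD u 0 2 t x))]
  · refine mul_sq_le_of_integral_le (f := fun x => √β * mixedD u 0 1 t x)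
      (f' := fun x => √β * mixedD u 0 2 t x) (fun x => (hx 1 x).const_mul _) (by fun_prop)
      (by simpa using (hlim 1 (by norm_num)).const_mul √β) (fun R hR => ?_) x
    refine le_trans (intervalIntegral.integral_mono_on (by linarith)
      (Continuous.intervalIntegrable (by fun_prop) _ _) (cE.intervalIntegrable _ _)
      fun x _ => ?_) (hE R hR)
    simp only [mul_pow, hb]
    nlinarith [sq_nonneg (mixedD u 0 0 t x)]

theorem dissipation_lower_bound (hu : IsAdmissibleKdVRLW ε β u) (hε : 0 < ε) (hβ : 0 < β)
    (hsmall : 200 * C0 * √β ≤ ε ^ 2) (hd : DataBoundsKdVRLW ε β C0 (u 0)) {t : ℝ} (ht : 0 < t)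
    (x : ℝ) :
    1 / 32 * (β * ε * mixedD u 1 1 t x ^ 2 + β ^ 2 * ε * mixedD u 1 2 t x ^ 2
        + β ^ 3 * ε * mixedD u 1 3 t x ^ 2 + β ^ 2 * ε * mixedD u 0 3 t x ^ 2
        + ε * (mixedD u 0 0 t x * mixedD u 0 1 t x) ^ 2 + ε ^ 3 * mixedD u 0 2 t x ^ 2)
      ≤ totalDissipation ε β (mixedD u 0 0 t x) (mixedD u 0 1 t x) (mixedD u 0 2 t x)
          (mixedD u 0 3 t x) (mixedD u 1 1 t x) (mixedD u 1 2 t x) (mixedD u 1 3 t x) := by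
  obtain ⟨h0, h1⟩ := hu.pointwise_le hε hβ hd ht x
  have hb0 := Real.sqrt_nonneg β
  have hb : √β * √β = β := Real.mul_self_sqrt hβ.le
  refine dissipation_coercive hε hβ ?_ ?_
  · have := mul_le_mul_of_nonneg_left h0 hb0
    rw [← mul_assoc, hb] at this
    linarith
  · have := mul_le_mul_of_nonneg_left h1 hb0
    rw [mul_pow, sq √β, ← mul_assoc, ← mul_assoc, hb] at this
    rw [mul_pow, sq β]
    linarith

theorem integral_totalDissipation_le (hu : IsAdmissibleKdVRLW ε β u) (hε : 0 < ε) (hβ : 0 < β)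
    (hsmall : 200 * C0 * √β ≤ ε ^ 2) (hd : DataBoundsKdVRLW ε β C0 (u 0)) {T R : ℝ}
    (hT : 0 < T) (hR : 0 < R) :
    ∫ s in (0 : ℝ)..T, ∫ x in -R..R, totalDissipation ε β (mixedD u 0 0 s x) (mixedD u 0 1 s x)
      (mixedD u 0 2 s x) (mixedD u 0 3 s x) (mixedD u 1 1 s x) (mixedD u 1 2 s x)
      (mixedD u 1 3 s x) ≤ 3 * C0 := by
  have hx := hasDerivAt_mixedD_snd hu.contDiff_uncurry
  have ht := hasDerivAt_mixedD_fst hu.contDiff_uncurry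
  have cU := hu.continuous_mixedD
  have dU : ∀ {j k : ℕ}, j + k ≤ 5 → Tendsto (fun p : ℝ × ℝ => mixedD u j k p.1 p.2)
      (𝓟 (Icc 0 T) ×ˢ cocompact ℝ) (nhds 0) := hu.tendsto_mixedD hT
  have epos : ∀ t x, 0 ≤ totalEnergy ε β (mixedD u 0 0 t x) (mixedD u 0 1 t x)
      (mixedD u 0 2 t x) (mixedD u 0 3 t x) (mixedD u 0 4 t x) := by
    intro t x
    unfold totalEnergy
    positivity
  have key := box_energy_le (K := 3 * C0) hT.le
    (e := fun t x => totalEnergy ε β (mixedD u 0 0 t x) (mixedD u 0 1 t x)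
      (mixedD u 0 2 t x) (mixedD u 0 3 t x) (mixedD u 0 4 t x))
    (e' := fun t x => totalEnergyRate ε β (mixedD u 0 0 t x) (mixedD u 0 1 t x)
      (mixedD u 0 2 t x) (mixedD u 0 3 t x) (mixedD u 0 4 t x) (mixedD u 1 0 t x)
      (mixedD u 1 1 t x) (mixedD u 1 2 t x) (mixedD u 1 3 t x) (mixedD u 1 4 t x))
    (F := fun t x => totalFlux ε β (mixedD u 0 0 t x) (mixedD u 0 1 t x)
      (mixedD u 0 2 t x) (mixedD u 0 3 t x) (mixedD u 1 0 t x)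
      (mixedD u 1 1 t x) (mixedD u 1 2 t x) (mixedD u 1 3 t x))
    (F' := fun t x => totalFluxDeriv ε β (mixedD u 0 0 t x) (mixedD u 0 1 t x)
      (mixedD u 0 2 t x) (mixedD u 0 3 t x) (mixedD u 0 4 t x) (mixedD u 1 0 t x)
      (mixedD u 1 1 t x) (mixedD u 1 2 t x) (mixedD u 1 3 t x) (mixedD u 1 4 t x))
    (Q := fun t x => totalDissipation ε β (mixedD u 0 0 t x) (mixedD u 0 1 t x)
      (mixedD u 0 2 t x) (mixedD u 0 3 t x) (mixedD u 1 1 t x) (mixedD u 1 2 t x)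
      (mixedD u 1 3 t x))
    (fun t x => hasDerivAt_totalEnergy ε β (ht 0 0 t x) (ht 0 1 t x) (ht 0 2 t x) (ht 0 3 t x)
      (ht 0 4 t x))
    (fun t x => hasDerivAt_totalFlux ε β (hx 0 0 t x) (hx 0 1 t x) (hx 0 2 t x) (hx 0 3 t x)
      (hx 1 0 t x) (hx 1 1 t x) (hx 1 2 t x) (hx 1 3 t x))
    (by simp only [Function.uncurry_def, totalEnergy]; fun_prop)
    (by simp only [Function.uncurry_def, totalEnergyRate]; fun_prop)
    (by
      simp only [Function.uncurry_def, totalFluxDeriv, totalEnergyRate, totalDissipation]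
      fun_prop)
    (by simp only [Function.uncurry_def, totalDissipation]; fun_prop)
    ?_
    (tendsto_totalFlux ε β (dU (by norm_num)) (dU (by norm_num)) (dU (by norm_num))
      (dU (by norm_num)) (dU (by norm_num)) (dU (by norm_num)) (dU (by norm_num))
      (dU (by norm_num)))
    (fun R hR => (hu.initial_le hε hβ hd hR).2) epos ?_ hR
  · have : 0 ≤ ∫ x in -R..R, totalEnergy ε β (mixedD u 0 0 T x) (mixedD u 0 1 T x)
        (mixedD u 0 2 T x) (mixedD u 0 3 T x) (mixedD u 0 4 T x) :=
      intervalIntegral.integral_nonneg (by linarith) fun x _ => epos T x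
    linarith
  · intro t ht0 x
    simp only [totalFluxDeriv, hu.residual_eq_zero ht0 x]
    ring
  · intro t ht0 x
    refine le_trans ?_ (hu.dissipation_lower_bound hε hβ hsmall hd ht0.1 x)
    positivity

/-- A dissipated quantity has a space-time integral bounded by the data. -/
theorem mul_integral_sqL2_le_of_le_dissipation (hu : IsAdmissibleKdVRLW ε β u) (hε : 0 < ε)
    (hβ : 0 < β) (hC0 : 0 < C0) (hsmall : 200 * C0 * √β ≤ ε ^ 2)
    (hd : DataBoundsKdVRLW ε β C0 (u 0)) {T κ : ℝ} (hT : 0 < T) {g : ℝ → ℝ → ℝ}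
    (cg : Continuous (Function.uncurry g)) (hg : ∀ s ∈ Ioc 0 T, Integrable fun x => g s x ^ 2)
    (hgQ : ∀ s x, κ * g s x ^ 2 ≤ β * ε * mixedD u 1 1 s x ^ 2
      + β ^ 2 * ε * mixedD u 1 2 s x ^ 2 + β ^ 3 * ε * mixedD u 1 3 s x ^ 2
      + β ^ 2 * ε * mixedD u 0 3 s x ^ 2 + ε * (mixedD u 0 0 s x * mixedD u 0 1 s x) ^ 2
      + ε ^ 3 * mixedD u 0 2 s x ^ 2) :
    κ * ∫ s in (0 : ℝ)..T, sqL2 (g s) ≤ 96 * C0 := by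
  have cU := hu.continuous_mixedD
  have := mul_integral_sqL2_le (κ := 1 / 32 * κ) hT.le cg
    (Q := fun t x => totalDissipation ε β (mixedD u 0 0 t x) (mixedD u 0 1 t x)
      (mixedD u 0 2 t x) (mixedD u 0 3 t x) (mixedD u 1 1 t x) (mixedD u 1 2 t x)
      (mixedD u 1 3 t x))
    (by simp only [Function.uncurry_def, totalDissipation]; fun_prop) hg
    (fun s hs x => by
      refine le_trans ?_ (hu.dissipation_lower_bound hε hβ hsmall hd hs.1 x)
      linarith [hgQ s x])
    (by positivity) (fun R hR => hu.integral_totalDissipation_le hε hβ hsmall hd hT hR)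
  linarith

end IsAdmissibleKdVRLW

/-- Space–time integral bounds for the Rosenau–KdV–RLW approximation (★). -/
theorem spacetime_bounds_KdVRLW (C0 : ℝ) (hC0 : 0 < C0) :
    ∃ D : ℝ, 0 < D ∧ ∃ C : ℝ, 0 < C ∧
      ∀ ε β : ℝ, 0 < ε → 0 < β → β ≤ D ^ 2 * ε ^ 4 →
        ∀ u : ℝ → ℝ → ℝ, IsAdmissibleKdVRLW ε β u →
          DataBoundsKdVRLW ε β C0 (u 0) →
          ∀ t > (0 : ℝ),
            β * ε * (∫ s in (0 : ℝ)..t, sqL2 (fun x => mixedD u 1 1 s x)) ≤ C ∧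
            β ^ 2 * ε * (∫ s in (0 : ℝ)..t, sqL2 (fun x => mixedD u 1 2 s x)) ≤ C ∧
            β ^ 3 * ε * (∫ s in (0 : ℝ)..t, sqL2 (fun x => mixedD u 1 3 s x)) ≤ C ∧
            β ^ 2 * ε * (∫ s in (0 : ℝ)..t, sqL2 (fun x => mixedD u 0 3 s x)) ≤ C ∧
            ε * (∫ s in (0 : ℝ)..t, sqL2 (fun x => u s x * mixedD u 0 1 s x)) ≤ C ∧
            ε ^ 3 * (∫ s in (0 : ℝ)..t, sqL2 (fun x => mixedD u 0 2 s x)) ≤ C := by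
  refine ⟨1 / (200 * C0), by positivity, 96 * C0, by positivity, ?_⟩
  intro ε β hε hβ hβε u hu hd T hT
  have hsmall : 200 * C0 * √β ≤ ε ^ 2 := by
    have h1 : √β ≤ 1 / (200 * C0) * ε ^ 2 :=
      Real.sqrt_le_iff.2 ⟨by positivity, hβε.trans_eq (by ring)⟩
    rw [one_div, inv_mul_eq_div, le_div_iff₀ (by positivity)] at h1
    linarith
  have main := fun {κ : ℝ} {g : ℝ → ℝ → ℝ} => hu.mul_integral_sqL2_le_of_le_dissipation hε hβ hC0
    hsmall hd (κ := κ) hT (g := g)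
  have cU := hu.continuous_mixedD
  have iU : ∀ j k, j + k ≤ 5 → ∀ s ∈ Ioc 0 T, Integrable fun x => mixedD u j k s x ^ 2 :=
    fun j k h s hs => hu.sq_int T hT j k h s (Ioc_subset_Icc_self hs)
  have n1 : ∀ s x, 0 ≤ β * ε * mixedD u 1 1 s x ^ 2 := fun s x => by positivity
  have n2 : ∀ s x, 0 ≤ β ^ 2 * ε * mixedD u 1 2 s x ^ 2 := fun s x => by positivity
  have n3 : ∀ s x, 0 ≤ β ^ 3 * ε * mixedD u 1 3 s x ^ 2 := fun s x => by positivity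
  have n4 : ∀ s x, 0 ≤ β ^ 2 * ε * mixedD u 0 3 s x ^ 2 := fun s x => by positivity
  have n5 : ∀ s x, 0 ≤ ε * (mixedD u 0 0 s x * mixedD u 0 1 s x) ^ 2 := fun s x => by positivity
  have n6 : ∀ s x, 0 ≤ ε ^ 3 * mixedD u 0 2 s x ^ 2 := fun s x => by positivity
  have hprod : ε * ∫ s in (0 : ℝ)..T, sqL2 (fun x => mixedD u 0 0 s x * mixedD u 0 1 s x)
      ≤ 96 * C0 :=
    main (g := fun s x => mixedD u 0 0 s x * mixedD u 0 1 s x) ((cU 0 0).mul (cU 0 1))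
      (fun s hs => hu.integrable_sq_mul hs.1.le (by norm_num)) fun s x => by
        linarith [n1 s x, n2 s x, n3 s x, n4 s x, n5 s x, n6 s x]
  simp only [mixedD_zero_zero] at hprod
  refine ⟨main (cU 1 1) (iU 1 1 (by norm_num)) fun s x => ?_,
    main (cU 1 2) (iU 1 2 (by norm_num)) fun s x => ?_,
    main (cU 1 3) (iU 1 3 (by norm_num)) fun s x => ?_,
    main (cU 0 3) (iU 0 3 (by norm_num)) fun s x => ?_, hprod,
    main (cU 0 2) (iU 0 2 (by norm_num)) fun s x => ?_⟩ <;>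
  linarith [n1 s x, n2 s x, n3 s x, n4 s x, n5 s x, n6 s x]

end
end

section
/- There exists D > 0 depending only on C₀ such that the following holds: if ε, β > 0 satisfy β ≤ D²ε⁴ and u is an admissible solution of (★) whose initial datum satisfies the data bounds with constant C₀, then there is a constant C depending only on C₀ such that for every t > 0: β² ∫₀ᵗ ‖∂_x² u(s,·)‖²_{L²(ℝ)} ds ≤ C ε⁵. -/
open MeasureTheory Real Filter Set

noncomputable section

/-- The derivative of `f` in the direction `v`. -/
def dirDeriv (v : ℝ × ℝ) (f : ℝ × ℝ → ℝ) (p : ℝ × ℝ) : ℝ := fderiv ℝ f p v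

/-- `jet f j k`: `j` derivatives in the first variable of the `k`-th derivative of `f` in the
second variable. -/
def jet (f : ℝ × ℝ → ℝ) (j k : ℕ) : ℝ × ℝ → ℝ :=
  (dirDeriv (1, 0))^[j] ((dirDeriv (0, 1))^[k] f)

lemma ContDiff.dirDeriv {f : ℝ × ℝ → ℝ} (hf : ContDiff ℝ (⊤ : ℕ∞) f) (v : ℝ × ℝ) :
    ContDiff ℝ (⊤ : ℕ∞) (dirDeriv v f) :=
  (hf.fderiv_right (m := (⊤ : ℕ∞)) (by simp)).clm_apply contDiff_const

lemma ContDiff.iterate_dirDeriv {f : ℝ × ℝ → ℝ} (hf : ContDiff ℝ (⊤ : ℕ∞) f) (v : ℝ × ℝ)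
    (n : ℕ) :
    ContDiff ℝ (⊤ : ℕ∞) ((_root_.dirDeriv v)^[n] f) := by
  induction n with
  | zero => exact hf
  | succ n ih => rw [Function.iterate_succ_apply']; exact ih.dirDeriv v

lemma dirDeriv_comm {f : ℝ × ℝ → ℝ} (hf : ContDiff ℝ (⊤ : ℕ∞) f) (v w : ℝ × ℝ) :
    dirDeriv v (dirDeriv w f) = dirDeriv w (dirDeriv v f) := by
  have key (p v w : ℝ × ℝ) :
      fderiv ℝ (fun q => fderiv ℝ f q w) p v = fderiv ℝ (fderiv ℝ f) p v w := by
    have h : DifferentiableAt ℝ (fderiv ℝ f) p :=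
      (hf.fderiv_right (m := (⊤ : ℕ∞)) (by simp)).differentiable (by simp) p
    rw [fderiv_clm_apply h (by fun_prop)]
    simp
  ext p
  change fderiv ℝ (fun q => fderiv ℝ f q w) p v = fderiv ℝ (fun q => fderiv ℝ f q v) p w
  rw [key, key]
  refine (hf.contDiffAt.isSymmSndFDerivAt ?_).eq v w
  simp only [minSmoothness_of_isRCLikeNormedField]
  exact WithTop.coe_le_coe.2 (le_top : (2 : ℕ∞) ≤ ⊤)

lemma dirDeriv_iterate_comm {f : ℝ × ℝ → ℝ} (hf : ContDiff ℝ (⊤ : ℕ∞) f) (v w : ℝ × ℝ) (n : ℕ) :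
    dirDeriv v ((dirDeriv w)^[n] f) = (dirDeriv w)^[n] (dirDeriv v f) := by
  induction n with
  | zero => rfl
  | succ n ih =>
    rw [Function.iterate_succ_apply', dirDeriv_comm (hf.iterate_dirDeriv w n), ih,
      ← Function.iterate_succ_apply' (dirDeriv w)]

lemma hasDerivAt_fst {f : ℝ × ℝ → ℝ} (hf : ContDiff ℝ 1 f) (t x : ℝ) :
    HasDerivAt (fun s => f (s, x)) (fderiv ℝ f (t, x) (1, 0)) t := by
  have h := (hf.differentiable (by simp) (t, x)).hasFDerivAt
  exact h.comp_hasDerivAt t ((hasDerivAt_id t).prodMk (hasDerivAt_const t x))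

lemma hasDerivAt_snd {f : ℝ × ℝ → ℝ} (hf : ContDiff ℝ 1 f) (t x : ℝ) :
    HasDerivAt (fun y => f (t, y)) (fderiv ℝ f (t, x) (0, 1)) x := by
  have h := (hf.differentiable (by simp) (t, x)).hasFDerivAt
  exact h.comp_hasDerivAt x ((hasDerivAt_const x t).prodMk (hasDerivAt_id x))

lemma contDiff_jet {f : ℝ × ℝ → ℝ} (hf : ContDiff ℝ (⊤ : ℕ∞) f) (j k : ℕ) :
    ContDiff ℝ (⊤ : ℕ∞) (jet f j k) :=
  (hf.iterate_dirDeriv _ k).iterate_dirDeriv _ j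

lemma hasDerivAt_jet_fst {f : ℝ × ℝ → ℝ} (hf : ContDiff ℝ (⊤ : ℕ∞) f) (j k : ℕ) (t x : ℝ) :
    HasDerivAt (fun s => jet f j k (s, x)) (jet f (j + 1) k (t, x)) t := by
  have h := hasDerivAt_fst ((contDiff_jet hf j k).of_le (by simp)) t x
  rwa [show jet f (j + 1) k = dirDeriv (1, 0) (jet f j k) from Function.iterate_succ_apply' ..]

lemma hasDerivAt_jet_snd {f : ℝ × ℝ → ℝ} (hf : ContDiff ℝ (⊤ : ℕ∞) f) (j k : ℕ) (t x : ℝ) :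
    HasDerivAt (fun y => jet f j k (t, y)) (jet f j (k + 1) (t, x)) x := by
  have h := hasDerivAt_snd ((contDiff_jet hf j k).of_le (by simp)) t x
  have hj : jet f j (k + 1) = dirDeriv (0, 1) (jet f j k) := by
    rw [jet, Function.iterate_succ_apply', jet, dirDeriv_iterate_comm (hf.iterate_dirDeriv _ k)]
  rwa [hj]

lemma mixedD_eq_jet {u : ℝ → ℝ → ℝ} (hu : ContDiff ℝ (⊤ : ℕ∞) (Function.uncurry u)) (j k : ℕ)
    (t x : ℝ) : mixedD u j k t x = jet (Function.uncurry u) j k (t, x) := by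
  have hx (k : ℕ) : ∀ s y, iteratedDeriv k (fun y => u s y) y
      = jet (Function.uncurry u) 0 k (s, y) := by
    induction k with
    | zero => intro s y; simp [jet]
    | succ k ih =>
      intro s y
      rw [iteratedDeriv_succ, funext (ih s)]
      exact (hasDerivAt_jet_snd hu 0 k s y).deriv
  unfold mixedD
  simp only [hx]
  induction j generalizing t with
  | zero => simp
  | succ j ih =>
    rw [iteratedDeriv_succ, funext ih]
    exact (hasDerivAt_jet_fst hu j k t x).deriv

/-- `f (t, x) → 0` as `|x| → ∞`, uniformly for `t ∈ [0, T]`. -/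
def VanishesAtInfty (T : ℝ) (f : ℝ × ℝ → ℝ) : Prop :=
  Tendsto f (𝓟 (Icc 0 T) ×ˢ comap abs atTop) (nhds 0)

lemma vanishesAtInfty_iff {T : ℝ} {f : ℝ × ℝ → ℝ} :
    VanishesAtInfty T f ↔
      ∀ δ > 0, ∃ M : ℝ, ∀ x : ℝ, M ≤ |x| → ∀ t ∈ Icc 0 T, |f (t, x)| ≤ δ := by
  have hb : (𝓟 (Icc 0 T) ×ˢ comap abs atTop : Filter (ℝ × ℝ)).HasBasis (fun _ : ℝ => True)
      (fun M => Icc 0 T ×ˢ (abs ⁻¹' Ici M)) := by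
    have := (hasBasis_principal (Icc (0 : ℝ) T)).prod ((atTop_basis (α := ℝ)).comap abs)
    refine this.to_hasBasis (fun i _ => ⟨i.2, trivial, subset_rfl⟩)
      (fun M _ => ⟨((), M), ⟨trivial, trivial⟩, subset_rfl⟩)
  rw [VanishesAtInfty, hb.tendsto_iff Metric.nhds_basis_closedBall]
  simp only [Set.mem_prod, mem_preimage, mem_Ici, Metric.mem_closedBall, Real.dist_eq, sub_zero,
    true_and, Prod.forall]
  exact forall₂_congr fun δ _ => exists_congr fun M =>
    ⟨fun h x hx t ht => h t x ⟨ht, hx⟩, fun h t x hx => h x hx.2 t hx.1⟩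

lemma integral_energy_le {e φ q et φx : ℝ × ℝ → ℝ} {t B R₀ : ℝ} (ht : 0 ≤ t) (hR₀ : 0 ≤ R₀)
    (he : ContDiff ℝ 1 e) (hφ : ContDiff ℝ 1 φ) (hq : Continuous q)
    (het : ∀ s x, HasDerivAt (fun s => e (s, x)) (et (s, x)) s)
    (hφx : ∀ s x, HasDerivAt (fun y => φ (s, y)) (φx (s, x)) x)
    (hdiv : ∀ s > 0, ∀ x, et (s, x) + φx (s, x) + q (s, x) ≤ 0)
    (he0 : ∀ p, 0 ≤ e p) (hq0 : ∀ p, 0 ≤ q p) (hφ0 : VanishesAtInfty t φ)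
    (hfi : Integrable (fun x => e (0, x))) (hB : ∫ x, e (0, x) ≤ B) :
    (∫ x in -R₀..R₀, e (t, x)) + (∫ s in 0..t, ∫ x in -R₀..R₀, q (s, x)) ≤ B := by
  have hec := he.continuous
  have hφc := hφ.continuous
  have hdc : Continuous fun p => fderiv ℝ e p (1, 0) + fderiv ℝ φ p (0, 1) :=
    ((he.continuous_fderiv (by simp)).clm_apply continuous_const).add
      ((hφ.continuous_fderiv (by simp)).clm_apply continuous_const)
  have cont_par {g : ℝ × ℝ → ℝ} (hg : Continuous g) (a b : ℝ) :
      Continuous fun s => ∫ x in a..b, g (s, x) :=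
    intervalIntegral.continuous_parametric_intervalIntegral_of_continuous' (by exact hg) a b
  refine le_of_forall_pos_le_add fun η hη => ?_
  obtain ⟨M, hM⟩ := vanishesAtInfty_iff.1 hφ0 (η / (2 * t + 1)) (by positivity)
  set δ := η / (2 * t + 1) with hδ
  have hδt : 2 * (δ * t) ≤ η := by
    rw [hδ, div_mul_eq_mul_div, mul_div_assoc', div_le_iff₀ (by positivity)]
    nlinarith
  set R := max R₀ M
  have hR : 0 ≤ R := hR₀.trans (le_max_left _ _)
  have hRR : R₀ ≤ R := le_max_left _ _
  have hMR : M ≤ |R| := (le_max_right _ _).trans (le_abs_self _)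
  have key := integral2_divergence_prod_of_hasFDerivAt e φ (fderiv ℝ e) (fderiv ℝ φ) 0 (-R) t R
    hec.continuousOn hφc.continuousOn
    (fun p _ => (he.differentiable (by simp) p).hasFDerivAt)
    (fun p _ => (hφ.differentiable (by simp) p).hasFDerivAt)
    (hdc.continuousOn.integrableOn_compact (isCompact_uIcc.prod isCompact_uIcc))
  have hle : (∫ s in 0..t, ∫ x in -R..R, (fderiv ℝ e (s, x) (1, 0) + fderiv ℝ φ (s, x) (0, 1)))
      ≤ ∫ s in 0..t, ∫ x in -R..R, -q (s, x) := by
    refine intervalIntegral.integral_mono_on_of_le_Ioo ht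
      ((cont_par hdc _ _).intervalIntegrable _ _)
      ((cont_par hq.neg _ _).intervalIntegrable _ _) fun s hs => ?_
    refine intervalIntegral.integral_mono_on (by linarith)
      (Continuous.intervalIntegrable (hdc.comp (Continuous.prodMk_right s)) _ _)
      (Continuous.intervalIntegrable (by fun_prop) _ _) fun x _ => ?_
    rw [(hasDerivAt_fst he s x).unique (het s x), (hasDerivAt_snd hφ s x).unique (hφx s x)]
    linarith [hdiv s hs.1 x]
  simp only [intervalIntegral.integral_neg] at hle
  have hbd (y : ℝ) (hy : M ≤ |y|) : |∫ s in 0..t, φ (s, y)| ≤ δ * t := by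
    have := intervalIntegral.norm_integral_le_of_norm_le_const (a := 0) (b := t) (C := δ)
      (f := fun s => φ (s, y)) fun s hs => by
        rw [uIoc_of_le ht] at hs
        exact hM y hy s ⟨hs.1.le, hs.2⟩
    simpa [abs_of_nonneg ht] using this
  have h1 := abs_le.1 (hbd R hMR)
  have h2 := abs_le.1 (hbd (-R) (by rwa [abs_neg]))
  have h3 : ∫ x in -R..R, e (0, x) ≤ B := by
    rw [intervalIntegral.integral_of_le (by linarith)]
    exact (setIntegral_le_integral hfi (.of_forall fun x => he0 _)).trans hB
  have mono (g : ℝ → ℝ) (hg : Continuous g) (hg0 : ∀ x, 0 ≤ g x) :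
      ∫ x in -R₀..R₀, g x ≤ ∫ x in -R..R, g x :=
    intervalIntegral.integral_mono_interval (by linarith) (by linarith) hRR
      (.of_forall hg0) (hg.intervalIntegrable _ _)
  have h4 := mono (fun x => e (t, x)) (by fun_prop) fun x => he0 _
  have h5 : (∫ s in 0..t, ∫ x in -R₀..R₀, q (s, x)) ≤ ∫ s in 0..t, ∫ x in -R..R, q (s, x) :=
    intervalIntegral.integral_mono_on ht ((cont_par hq _ _).intervalIntegrable _ _)
      ((cont_par hq _ _).intervalIntegrable _ _)
      fun s _ => mono (fun x => q (s, x)) (by fun_prop) fun x => hq0 _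
  linarith [h1.1, h2.2]

lemma mul_integral_sqL2_le_s8 {f : ℝ × ℝ → ℝ} {t c B : ℝ} (ht : 0 ≤ t) (hB : 0 ≤ B) (hf : Continuous f)
    (hfi : ∀ s ∈ Icc 0 t, Integrable (fun x => f (s, x) ^ 2))
    (h : ∀ R : ℝ, 0 ≤ R → (∫ s in 0..t, ∫ x in -R..R, c * f (s, x) ^ 2) ≤ B) :
    c * (∫ s in 0..t, sqL2 (fun x => f (s, x))) ≤ B := by
  by_cases hi : IntervalIntegrable (fun s => sqL2 (fun x => f (s, x))) volume 0 t
  · have hlim : Tendsto (fun R : ℝ => ∫ s in 0..t, ∫ x in -R..R, f (s, x) ^ 2) atTop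
        (nhds (∫ s in 0..t, sqL2 (fun x => f (s, x)))) := by
      have hs {s : ℝ} (hs : s ∈ uIoc 0 t) : s ∈ Icc 0 t := by
        rw [uIoc_of_le ht] at hs
        exact ⟨hs.1.le, hs.2⟩
      refine intervalIntegral.tendsto_integral_filter_of_dominated_convergence _
        (.of_forall fun R => ?_) ?_ hi (.of_forall fun s hs' => ?_)
      · exact (intervalIntegral.continuous_parametric_intervalIntegral_of_continuous'
          (f := fun s x => f (s, x) ^ 2) (by exact hf.pow 2) (-R) R).aestronglyMeasurable
      · filter_upwards [eventually_ge_atTop 0] with R hR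
        refine .of_forall fun s hs' => ?_
        rw [intervalIntegral.integral_of_le (by linarith), Real.norm_of_nonneg
          (setIntegral_nonneg measurableSet_Ioc fun x _ => sq_nonneg _)]
        exact setIntegral_le_integral (hfi s (hs hs')) (.of_forall fun x => sq_nonneg _)
      · exact intervalIntegral_tendsto_integral (hfi s (hs hs')) tendsto_neg_atTop_atBot tendsto_id
    refine le_of_tendsto (hlim.const_mul c) ?_
    filter_upwards [eventually_ge_atTop 0] with R hR
    simpa only [intervalIntegral.integral_const_mul] using h R hR
  · rw [intervalIntegral.integral_undef hi, mul_zero]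
    exact hB

/-- Density of the energy obtained from the multiplier `l u + m u³ + k ∂ₜu - n ∂ₓ²u`; the argument
`a i` is `∂ₓⁱu`. -/
def energyDensity (ε β l m k n : ℝ) (a : ℕ → ℝ) : ℝ :=
  l / 2 * (a 0 ^ 2 + β * a 1 ^ 2 + β ^ 2 * a 2 ^ 2) + m / 4 * a 0 ^ 4 + k * ε / 2 * a 1 ^ 2
    + n / 2 * (a 1 ^ 2 + β * a 2 ^ 2 + β ^ 2 * a 3 ^ 2)

/-- Flux belonging to `energyDensity`; `b i` is `∂ₜ∂ₓⁱu`. -/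
def energyFlux (ε β l m k n : ℝ) (a b : ℕ → ℝ) : ℝ :=
  l * (2 / 3 * a 0 ^ 3 + β * (a 0 * a 2 - a 1 ^ 2 / 2) - β * (a 0 * b 1)
      + β ^ 2 * (a 0 * b 3 - a 1 * b 2) - ε * (a 0 * a 1))
    + m * (2 / 5 * a 0 ^ 5 + β * (a 0 ^ 3 * a 2) - β * (a 0 ^ 3 * b 1)
      + β ^ 2 * (a 0 ^ 3 * b 3 - 3 * (a 0 ^ 2 * a 1 * b 2)) - ε * (a 0 ^ 3 * a 1))
    + k * (β * (b 0 * a 2) - β * (b 0 * b 1) + β ^ 2 * (b 0 * b 3 - b 1 * b 2) - ε * (b 0 * a 1))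
    + n * (-(a 1 * b 0) - β / 2 * a 2 ^ 2 - β ^ 2 * (a 2 * b 3))

/-- Dissipation belonging to `energyDensity`. -/
def energyDissipation (ε β l m k n : ℝ) (a b : ℕ → ℝ) : ℝ :=
  l * (ε * a 1 ^ 2)
    + m * (3 * ε * (a 0 * a 1) ^ 2 + 3 * β ^ 2 * (2 * a 0 * a 1 ^ 2 + a 0 ^ 2 * a 2) * b 2
      + 3 * β * a 0 ^ 2 * a 1 * b 1 - 3 * β * a 0 ^ 2 * a 1 * a 2)
    + k * (b 0 ^ 2 + β * b 1 ^ 2 + β ^ 2 * b 2 ^ 2 + 2 * a 0 * a 1 * b 0 - β * b 1 * a 2)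
    + n * (ε * a 2 ^ 2 - 2 * a 0 * a 1 * a 2)

lemma energyDensity_nonneg {ε β l m k n : ℝ} (hε : 0 ≤ ε) (hβ : 0 ≤ β) (hl : 0 ≤ l) (hm : 0 ≤ m)
    (hk : 0 ≤ k) (hn : 0 ≤ n) (a : ℕ → ℝ) : 0 ≤ energyDensity ε β l m k n a := by
  unfold energyDensity
  positivity

lemma energy_balance {ε β : ℝ} {a b : ℕ → ℝ → ℝ → ℝ} (l m k n s x : ℝ)
    (hat : ∀ i, HasDerivAt (fun s => a i s x) (b i s x) s)
    (hax : ∀ i, HasDerivAt (fun y => a i s y) (a (i + 1) s x) x)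
    (hbx : ∀ i, HasDerivAt (fun y => b i s y) (b (i + 1) s x) x)
    (hpde : b 0 s x + 2 * a 0 s x * a 1 s x + β * a 3 s x - β * b 2 s x + β ^ 2 * b 4 s x
      = ε * a 2 s x) :
    deriv (fun s => energyDensity ε β l m k n (a · s x)) s
      + deriv (fun y => energyFlux ε β l m k n (a · s y) (b · s y)) x
      = - energyDissipation ε β l m k n (a · s x) (b · s x) := by
  have a0 := hax 0
  have a1 := hax 1
  have a2 := hax 2
  have b0 := hbx 0
  have b1 := hbx 1
  have b2 := hbx 2
  have b3 := hbx 3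
  have h1 : HasDerivAt (fun s => energyDensity ε β l m k n (a · s x)) _ s :=
    ((((((hat 0).pow 2).add (((hat 1).pow 2).const_mul β)).add
      (((hat 2).pow 2).const_mul (β ^ 2))).const_mul (l / 2)).add
      (((hat 0).pow 4).const_mul (m / 4))).add (((hat 1).pow 2).const_mul (k * ε / 2)) |>.add
      (((((hat 1).pow 2).add (((hat 2).pow 2).const_mul β)).add
      (((hat 3).pow 2).const_mul (β ^ 2))).const_mul (n / 2))
  have hl : HasDerivAt (fun y => l * (2 / 3 * a 0 s y ^ 3
      + β * (a 0 s y * a 2 s y - a 1 s y ^ 2 / 2) - β * (a 0 s y * b 1 s y)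
      + β ^ 2 * (a 0 s y * b 3 s y - a 1 s y * b 2 s y) - ε * (a 0 s y * a 1 s y))) _ x :=
    ((((((a0.pow 3).const_mul (2 / 3)).add (((a0.mul a2).sub ((a1.pow 2).div_const 2)).const_mul β)).sub
      ((a0.mul b1).const_mul β)).add (((a0.mul b3).sub (a1.mul b2)).const_mul (β ^ 2))).sub
      ((a0.mul a1).const_mul ε)).const_mul l
  have hm : HasDerivAt (fun y => m * (2 / 5 * a 0 s y ^ 5
      + β * (a 0 s y ^ 3 * a 2 s y) - β * (a 0 s y ^ 3 * b 1 s y)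
      + β ^ 2 * (a 0 s y ^ 3 * b 3 s y - 3 * (a 0 s y ^ 2 * a 1 s y * b 2 s y))
      - ε * (a 0 s y ^ 3 * a 1 s y))) _ x :=
    ((((((a0.pow 5).const_mul (2 / 5)).add (((a0.pow 3).mul a2).const_mul β)).sub
      (((a0.pow 3).mul b1).const_mul β)).add ((((a0.pow 3).mul b3).sub
      ((((a0.pow 2).mul a1).mul b2).const_mul 3)).const_mul (β ^ 2))).sub
      (((a0.pow 3).mul a1).const_mul ε)).const_mul m
  have hk : HasDerivAt (fun y => k * (β * (b 0 s y * a 2 s y) - β * (b 0 s y * b 1 s y)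
      + β ^ 2 * (b 0 s y * b 3 s y - b 1 s y * b 2 s y) - ε * (b 0 s y * a 1 s y))) _ x :=
    (((((b0.mul a2).const_mul β).sub ((b0.mul b1).const_mul β)).add
      (((b0.mul b3).sub (b1.mul b2)).const_mul (β ^ 2))).sub ((b0.mul a1).const_mul ε)).const_mul k
  have hn : HasDerivAt (fun y => n * (-(a 1 s y * b 0 s y) - β / 2 * a 2 s y ^ 2
      - β ^ 2 * (a 2 s y * b 3 s y))) _ x :=
    ((((a1.mul b0).neg).sub ((a2.pow 2).const_mul (β / 2))).sub
      ((a2.mul b3).const_mul (β ^ 2))).const_mul n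
  have h2 : HasDerivAt (fun y => energyFlux ε β l m k n (a · s y) (b · s y)) _ x :=
    ((hl.add hm).add hk).add hn
  rw [h1.deriv, h2.deriv]
  simp only [energyDissipation, Pi.pow_apply, Pi.mul_apply]
  norm_num
  linear_combination (l * a 0 s x + m * a 0 s x ^ 3 + k * b 0 s x - n * a 2 s x) * hpde

namespace IsAdmissibleKdVRLW

variable {ε β : ℝ} {u : ℝ → ℝ → ℝ}

lemma jet_pde (hu : IsAdmissibleKdVRLW ε β u) {t : ℝ} (ht : 0 < t) (x : ℝ) :
    jet (Function.uncurry u) 1 0 (t, x)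
      + 2 * jet (Function.uncurry u) 0 0 (t, x) * jet (Function.uncurry u) 0 1 (t, x)
      + β * jet (Function.uncurry u) 0 3 (t, x) - β * jet (Function.uncurry u) 1 2 (t, x)
      + β ^ 2 * jet (Function.uncurry u) 1 4 (t, x) = ε * jet (Function.uncurry u) 0 2 (t, x) := by
  have hd : deriv (fun y => u t y ^ 2) x
      = 2 * jet (Function.uncurry u) 0 0 (t, x) * jet (Function.uncurry u) 0 1 (t, x) := by
    have h := (hasDerivAt_jet_snd (f := Function.uncurry u) hu.smooth 0 0 t x).pow 2
    exact (h.congr_deriv (by simp)).deriv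
  have h := hu.pde t ht x
  rw [hd] at h
  simpa only [mixedD_eq_jet hu.smooth] using h

lemma integrable_sq_jet (hu : IsAdmissibleKdVRLW ε β u) {j k : ℕ} (hjk : j + k ≤ 5) {t : ℝ}
    (ht : 0 ≤ t) : Integrable fun x => jet (Function.uncurry u) j k (t, x) ^ 2 := by
  simpa only [← mixedD_eq_jet hu.smooth] using
    hu.sq_int (t + 1) (by linarith) j k hjk t ⟨ht, by linarith⟩

lemma vanishesAtInfty_jet (hu : IsAdmissibleKdVRLW ε β u) {j k : ℕ} (hjk : j + k ≤ 5) (T : ℝ) :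
    VanishesAtInfty T (jet (Function.uncurry u) j k) := by
  refine vanishesAtInfty_iff.2 fun δ hδ => ?_
  obtain ⟨M, hM⟩ := hu.decay (|T| + 1) (by positivity) j k hjk δ hδ
  refine ⟨M, fun x hx t ht => ?_⟩
  rw [← mixedD_eq_jet hu.smooth]
  exact hM x hx t ⟨ht.1, ht.2.trans (by linarith [le_abs_self T])⟩

lemma integrable_fourth_power (hu : IsAdmissibleKdVRLW ε β u) :
    Integrable fun x => jet (Function.uncurry u) 0 0 (0, x) ^ 4 := by
  have hc : Continuous fun x : ℝ => jet (Function.uncurry u) 0 0 (0, x) :=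
    (contDiff_jet hu.smooth 0 0).continuous.comp (by fun_prop)
  obtain ⟨M, hM⟩ := vanishesAtInfty_iff.1 (hu.vanishesAtInfty_jet (j := 0) (k := 0) (by simp) 0)
    1 one_pos
  obtain ⟨K, hK⟩ := (isCompact_Icc (a := -M) (b := M)).exists_bound_of_continuousOn hc.continuousOn
  have hbd (x : ℝ) : |jet (Function.uncurry u) 0 0 (0, x)| ≤ max 1 K := by
    rcases le_total M |x| with h | h
    · exact (hM x h 0 (by simp)).trans (le_max_left _ _)
    · exact (hK x (abs_le.1 h)).trans (le_max_right _ _)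
  have h := (hu.integrable_sq_jet (j := 0) (k := 0) (by simp) le_rfl).bdd_mul
    (f := fun x => jet (Function.uncurry u) 0 0 (0, x) ^ 2) (c := max 1 K ^ 2)
    (hc.pow 2).aestronglyMeasurable
    (.of_forall fun x => by
      rw [norm_pow, Real.norm_eq_abs]
      exact pow_le_pow_left₀ (abs_nonneg _) (hbd x) 2)
  simpa only [← pow_add] using h

/-- Energy estimate with the multiplier `l u + m u³ + k ∂ₜu - n ∂ₓ²u`. -/
lemma energy_le_s8 (hu : IsAdmissibleKdVRLW ε β u) (hε : 0 ≤ ε) (hβ : 0 ≤ β) {l m k n c B : ℝ}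
    (hl : 0 ≤ l) (hm : 0 ≤ m) (hk : 0 ≤ k) (hn : 0 ≤ n) (hc : 0 ≤ c)
    (hdiss : ∀ s > 0, ∀ x, c * jet (Function.uncurry u) 0 2 (s, x) ^ 2
      ≤ energyDissipation ε β l m k n
      (fun i => jet (Function.uncurry u) 0 i (s, x)) (fun i => jet (Function.uncurry u) 1 i (s, x)))
    (hB : l / 2 * ((∫ x, jet (Function.uncurry u) 0 0 (0, x) ^ 2)
        + β * (∫ x, jet (Function.uncurry u) 0 1 (0, x) ^ 2)
        + β ^ 2 * ∫ x, jet (Function.uncurry u) 0 2 (0, x) ^ 2)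
      + m / 4 * (∫ x, jet (Function.uncurry u) 0 0 (0, x) ^ 4)
      + k * ε / 2 * (∫ x, jet (Function.uncurry u) 0 1 (0, x) ^ 2)
      + n / 2 * ((∫ x, jet (Function.uncurry u) 0 1 (0, x) ^ 2)
        + β * (∫ x, jet (Function.uncurry u) 0 2 (0, x) ^ 2)
        + β ^ 2 * ∫ x, jet (Function.uncurry u) 0 3 (0, x) ^ 2)
      ≤ B) {t R : ℝ} (ht : 0 ≤ t) (hR : 0 ≤ R) :
    (∫ x in -R..R, energyDensity ε β l m k n (fun i => jet (Function.uncurry u) 0 i (t, x)))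
      + (∫ s in 0..t, ∫ x in -R..R, c * jet (Function.uncurry u) 0 2 (s, x) ^ 2) ≤ B := by
  have hs (j k : ℕ) : ContDiff ℝ 1 (jet (Function.uncurry u) j k) :=
    (contDiff_jet hu.smooth j k).of_le (by simp)
  have he : ContDiff ℝ 1 fun p =>
      energyDensity ε β l m k n (fun i => jet (Function.uncurry u) 0 i p) := by
    unfold energyDensity
    fun_prop
  have hφ : ContDiff ℝ 1 fun p => energyFlux ε β l m k n (fun i => jet (Function.uncurry u) 0 i p)
      (fun i => jet (Function.uncurry u) 1 i p) := by
    unfold energyFlux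
    fun_prop
  have i0 := hu.integrable_sq_jet (j := 0) (k := 0) (by norm_num) le_rfl
  have i1 := hu.integrable_sq_jet (j := 0) (k := 1) (by norm_num) le_rfl
  have i2 := hu.integrable_sq_jet (j := 0) (k := 2) (by norm_num) le_rfl
  have i3 := hu.integrable_sq_jet (j := 0) (k := 3) (by norm_num) le_rfl
  have i4 := hu.integrable_fourth_power
  refine integral_energy_le
    (e := fun p => energyDensity ε β l m k n (fun i => jet (Function.uncurry u) 0 i p))
    (φ := fun p => energyFlux ε β l m k n (fun i => jet (Function.uncurry u) 0 i p)
      (fun i => jet (Function.uncurry u) 1 i p))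
    (q := fun p => c * jet (Function.uncurry u) 0 2 p ^ 2)
    (et := fun p => deriv (fun s => energyDensity ε β l m k n
      (fun i => jet (Function.uncurry u) 0 i (s, p.2))) p.1)
    (φx := fun p => deriv (fun y => energyFlux ε β l m k n
      (fun i => jet (Function.uncurry u) 0 i (p.1, y))
      (fun i => jet (Function.uncurry u) 1 i (p.1, y))) p.2)
    ht hR he hφ ?_ ?_ ?_ ?_ ?_ ?_ ?_ ?_ ?_
  · have := (hs 0 2).continuous
    fun_prop
  · exact fun s x => (hasDerivAt_fst he s x).differentiableAt.hasDerivAt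
  · exact fun s x => (hasDerivAt_snd hφ s x).differentiableAt.hasDerivAt
  · intro s hs x
    have := energy_balance (ε := ε) (β := β) (a := fun i s x => jet (Function.uncurry u) 0 i (s, x))
      (b := fun i s x => jet (Function.uncurry u) 1 i (s, x)) l m k n s x
      (fun i => hasDerivAt_jet_fst hu.smooth 0 i s x)
      (fun i => hasDerivAt_jet_snd hu.smooth 0 i s x)
      (fun i => hasDerivAt_jet_snd hu.smooth 1 i s x) (hu.jet_pde hs x)
    have := hdiss s hs x
    simp only at *
    linarith
  · exact fun p => energyDensity_nonneg hε hβ hl hm hk hn _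
  · exact fun p => by positivity
  · have hv (j k : ℕ) (h : j + k ≤ 5) := hu.vanishesAtInfty_jet h t
    have hΨ : Continuous fun v : (ℕ → ℝ) × (ℕ → ℝ) => energyFlux ε β l m k n v.1 v.2 := by
      unfold energyFlux
      fun_prop
    let cut (j : ℕ) (p : ℝ × ℝ) (i : ℕ) : ℝ := if i ≤ 3 then jet (Function.uncurry u) j i p else 0
    have hcut (j : ℕ) (hj : j ≤ 1) :
        Tendsto (cut j) (𝓟 (Icc 0 t) ×ˢ comap abs atTop) (nhds 0) := by
      refine tendsto_pi_nhds.2 fun i => ?_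
      by_cases h : i ≤ 3
      · simp only [cut, h, if_true]
        exact hv j i (by omega)
      · simp only [cut, h, if_false]
        exact tendsto_const_nhds
    have := (hΨ.tendsto' (0, 0) 0 (by simp [energyFlux])).comp
      ((hcut 0 (by simp)).prodMk_nhds (hcut 1 le_rfl))
    exact this
  · unfold energyDensity
    fun_prop
  · refine le_trans (le_of_eq ?_) hB
    unfold energyDensity
    rw [integral_add (by fun_prop) (by fun_prop), integral_add (by fun_prop) (by fun_prop),
      integral_add (by fun_prop) (by fun_prop)]
    simp only [integral_const_mul]
    rw [integral_add (by fun_prop) (by fun_prop), integral_add (by fun_prop) (by fun_prop),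
      integral_add (by fun_prop) (by fun_prop), integral_add (by fun_prop) (by fun_prop)]
    simp only [integral_const_mul]

end IsAdmissibleKdVRLW

lemma mul_sq_le_of_forall_integral_le {f g : ℝ → ℝ} {m B : ℝ} (hg : Continuous g)
    (hfg : ∀ x, HasDerivAt f (g x) x) (hf0 : Tendsto f atBot (nhds 0))
    (h : ∀ R : ℝ, 0 ≤ R → (∫ x in -R..R, (f x ^ 2 + m ^ 2 * g x ^ 2)) ≤ B) (x : ℝ) :
    m * f x ^ 2 ≤ B := by
  have hf : Continuous f := continuous_iff_continuousAt.2 fun x => (hfg x).continuousAt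
  have hlim : Tendsto (fun R : ℝ => B + m * f (-R) ^ 2) atTop (nhds (B + m * 0 ^ 2)) :=
    (((hf0.comp tendsto_neg_atTop_atBot).pow 2).const_mul m).const_add B
  refine le_of_le_of_eq (ge_of_tendsto hlim ?_) (by simp)
  filter_upwards [eventually_ge_atTop |x|] with R hR
  have hx := abs_le.1 hR
  have hftc : ∫ y in -R..x, 2 * m * (f y * g y) = m * f x ^ 2 - m * f (-R) ^ 2 :=
    intervalIntegral.integral_eq_sub_of_hasDerivAt
      (fun y _ => (((hfg y).pow 2).const_mul m).congr_deriv (by simp; ring))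
      (Continuous.intervalIntegrable (by fun_prop) _ _)
  have h1 : ∫ y in -R..x, 2 * m * (f y * g y) ≤ ∫ y in -R..x, (f y ^ 2 + m ^ 2 * g y ^ 2) :=
    intervalIntegral.integral_mono_on hx.1 (Continuous.intervalIntegrable (by fun_prop) _ _)
      (Continuous.intervalIntegrable (by fun_prop) _ _)
      fun y _ => by nlinarith [sq_nonneg (f y - m * g y)]
  have h2 : ∫ y in -R..x, (f y ^ 2 + m ^ 2 * g y ^ 2)
      ≤ ∫ y in -R..R, (f y ^ 2 + m ^ 2 * g y ^ 2) :=
    intervalIntegral.integral_mono_interval le_rfl hx.1 hx.2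
      (.of_forall fun y => by positivity) (Continuous.intervalIntegrable (by fun_prop) _ _)
  linarith [h R ((abs_nonneg x).trans hR)]

/-- The bounds of `DataBoundsKdVRLW` on the jet of the solution at time zero. -/
lemma DataBoundsKdVRLW.jet_bounds {ε β C0 : ℝ} {u : ℝ → ℝ → ℝ} (h : DataBoundsKdVRLW ε β C0 (u 0))
    (hu : IsAdmissibleKdVRLW ε β u) (hε : 0 ≤ ε) (hβ : 0 ≤ β) :
    (∫ x, jet (Function.uncurry u) 0 0 (0, x) ^ 2) + (∫ x, jet (Function.uncurry u) 0 0 (0, x) ^ 4)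
      + (β + ε ^ 2) * (∫ x, jet (Function.uncurry u) 0 1 (0, x) ^ 2) ≤ C0 ∧
    β ^ 2 * (∫ x, jet (Function.uncurry u) 0 2 (0, x) ^ 2) ≤ C0 ∧
    β * ε ^ 2 * (∫ x, jet (Function.uncurry u) 0 2 (0, x) ^ 2)
      + β ^ 2 * ε ^ 2 * (∫ x, jet (Function.uncurry u) 0 3 (0, x) ^ 2) ≤ C0 := by
  obtain ⟨h1, h2, -⟩ := h
  have hk (k : ℕ) : iteratedDeriv k (u 0) = fun x => jet (Function.uncurry u) 0 k (0, x) := by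
    ext x
    simpa [mixedD] using mixedD_eq_jet hu.smooth 0 k 0 x
  rw [← iteratedDeriv_one, hk] at h1
  rw [hk, hk] at h2
  have i2 : 0 ≤ ∫ x, jet (Function.uncurry u) 0 2 (0, x) ^ 2 := integral_nonneg fun x => sq_nonneg _
  have i3 : 0 ≤ ∫ x, jet (Function.uncurry u) 0 3 (0, x) ^ 2 := integral_nonneg fun x => sq_nonneg _
  have p1 : 0 ≤ β * ε * ∫ x, jet (Function.uncurry u) 0 2 (0, x) ^ 2 := by positivity
  have p2 : 0 ≤ β * ε ^ 2 * ∫ x, jet (Function.uncurry u) 0 2 (0, x) ^ 2 := by positivity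
  have p3 : 0 ≤ β ^ 2 * ∫ x, jet (Function.uncurry u) 0 2 (0, x) ^ 2 := by positivity
  have p4 : 0 ≤ β ^ 2 * ε ^ 2 * ∫ x, jet (Function.uncurry u) 0 3 (0, x) ^ 2 := by positivity
  have p5 : 0 ≤ β ^ 3 * ∫ x, jet (Function.uncurry u) 0 3 (0, x) ^ 2 := by positivity
  exact ⟨h1, by linarith, by linarith⟩

/-- Uniform bounds on `u` and `∂ₓu`, where `b = √β`. -/
lemma IsAdmissibleKdVRLW.sup_bounds {ε b C0 : ℝ} {u : ℝ → ℝ → ℝ}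
    (hu : IsAdmissibleKdVRLW ε (b ^ 2) u) (hε : 0 ≤ ε) (hb : 0 < b)
    (h : DataBoundsKdVRLW ε (b ^ 2) C0 (u 0)) {t : ℝ} (ht : 0 ≤ t) (x : ℝ) :
    b * jet (Function.uncurry u) 0 0 (t, x) ^ 2 ≤ 2 * C0 ∧
    b ^ 3 * jet (Function.uncurry u) 0 1 (t, x) ^ 2 ≤ 2 * C0 := by
  obtain ⟨h1, h2, -⟩ := h.jet_bounds hu hε (by positivity)
  have i1 : 0 ≤ ∫ x, jet (Function.uncurry u) 0 1 (0, x) ^ 2 := integral_nonneg fun x => sq_nonneg _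
  have i4 : 0 ≤ ∫ x, jet (Function.uncurry u) 0 0 (0, x) ^ 4 :=
    integral_nonneg fun x => by positivity
  have i1' : 0 ≤ ε ^ 2 * ∫ x, jet (Function.uncurry u) 0 1 (0, x) ^ 2 := by positivity
  have hs : ContDiff ℝ (⊤ : ℕ∞) (Function.uncurry u) := hu.smooth
  have hc (k : ℕ) : Continuous fun x => jet (Function.uncurry u) 0 k (t, x) :=
    (contDiff_jet hs 0 k).continuous.comp (by fun_prop)
  have hE (R : ℝ) (hR : 0 ≤ R) :
      ∫ x in -R..R, (jet (Function.uncurry u) 0 0 (t, x) ^ 2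
        + b ^ 2 * jet (Function.uncurry u) 0 1 (t, x) ^ 2
        + (b ^ 2) ^ 2 * jet (Function.uncurry u) 0 2 (t, x) ^ 2) ≤ 2 * C0 := by
    have := hu.energy_le_s8 hε (sq_nonneg b) (l := 2) (m := 0) (k := 0) (n := 0) (c := 0)
      (B := 2 * C0) (by norm_num) le_rfl le_rfl le_rfl le_rfl
      (fun s _ x => by simp only [energyDissipation]; ring_nf; positivity) (by linarith) ht hR
    simpa [energyDensity] using this
  have hlim (k : ℕ) (hk : k ≤ 5) :
      Tendsto (fun x => jet (Function.uncurry u) 0 k (t, x)) atBot (nhds 0) := by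
    refine Tendsto.comp (hu.vanishesAtInfty_jet (j := 0) (by omega) t)
      (tendsto_prod_iff'.2 ⟨?_, ?_⟩)
    · exact tendsto_principal.2 (.of_forall fun _ => ⟨ht, le_rfl⟩)
    · exact tendsto_comap_iff.2 tendsto_abs_atBot_atTop
  have mono {F G : ℝ → ℝ} (hF : Continuous F) (hG : Continuous G) (hle : ∀ x, F x ≤ G x) {R : ℝ}
      (hR : 0 ≤ R) : ∫ x in -R..R, F x ≤ ∫ x in -R..R, G x :=
    intervalIntegral.integral_mono_on (by linarith) (hF.intervalIntegrable _ _)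
      (hG.intervalIntegrable _ _) fun x _ => hle x
  have c0 := hc 0
  have c1 := hc 1
  have c2 := hc 2
  constructor
  · refine mul_sq_le_of_forall_integral_le c1 (hasDerivAt_jet_snd hs 0 0 t)
      (hlim 0 (by simp)) (fun R hR => ?_) x
    refine (mono (by fun_prop) (by fun_prop) (fun x => ?_) hR).trans (hE R hR)
    have : 0 ≤ (b ^ 2) ^ 2 * jet (Function.uncurry u) 0 2 (t, x) ^ 2 := by positivity
    linarith
  · have hb1 : Tendsto (fun x => b * jet (Function.uncurry u) 0 1 (t, x)) atBot (nhds 0) := by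
      simpa using (hlim 1 (by simp)).const_mul b
    have := mul_sq_le_of_forall_integral_le (m := b) (B := 2 * C0) (c2.const_mul b)
      (fun x => (hasDerivAt_jet_snd hs 0 1 t x).const_mul b) hb1 (fun R hR => ?_) x
    · linarith
    refine (mono (by fun_prop) (by fun_prop) (fun x => ?_) hR).trans (hE R hR)
    have : 0 ≤ jet (Function.uncurry u) 0 0 (t, x) ^ 2 := by positivity
    linarith

lemma le_energyDissipation_of_one_le {ε b B : ℝ} {a c : ℕ → ℝ} (hε : 0 < ε) (hb : 0 < b)
    (h0 : b * a 0 ^ 2 ≤ B) :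
    ε / 2 * a 2 ^ 2 ≤ energyDissipation ε (b ^ 2) (2 * B / (ε ^ 2 * b)) 0 0 1 a c := by
  have h1 : 2 / ε * (a 0 ^ 2 * a 1 ^ 2) ≤ 2 * B / (ε ^ 2 * b) * (ε * a 1 ^ 2) := by
    have : 2 * B / (ε ^ 2 * b) * (ε * a 1 ^ 2) = 2 / ε * (B / b * a 1 ^ 2) := by
      field_simp
    rw [this]
    gcongr
    rw [le_div_iff₀ hb]
    linarith
  have h2 : 2 * a 0 * a 1 * a 2 ≤ ε / 2 * a 2 ^ 2 + 2 / ε * (a 0 ^ 2 * a 1 ^ 2) := by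
    have : ε / 2 * a 2 ^ 2 + 2 / ε * (a 0 ^ 2 * a 1 ^ 2) - 2 * a 0 * a 1 * a 2
        = (ε * a 2 - 2 * a 0 * a 1) ^ 2 / (2 * ε) := by
      field_simp
      ring
    linarith [show 0 ≤ (ε * a 2 - 2 * a 0 * a 1) ^ 2 / (2 * ε) by positivity]
  simp only [energyDissipation]
  linarith

lemma quadForm_nonneg {A p q : ℝ} (hp : 0 < p) (h : A ^ 2 ≤ 4 * p * q) (x y : ℝ) :
    0 ≤ p * x ^ 2 + A * x * y + q * y ^ 2 := by
  have h4 : 4 * p * (p * x ^ 2 + A * x * y + q * y ^ 2)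
      = (2 * p * x + A * y) ^ 2 + (4 * p * q - A ^ 2) * y ^ 2 := by ring
  refine nonneg_of_mul_nonneg_right (?_ : 0 ≤ 4 * p * _) (by positivity)
  rw [h4]
  exact add_nonneg (sq_nonneg _) (mul_nonneg (sub_nonneg.2 h) (sq_nonneg y))

lemma le_energyDissipation_of_le_one {ε b B D : ℝ} {a c : ℕ → ℝ} (hε : 0 < ε) (hε1 : ε ≤ 1)
    (hb : 0 < b) (hD1 : D ≤ 1 / 10) (hBD : B * D ≤ 1 / 1000) (hbD : b ≤ D * ε ^ 2)
    (h0 : b * a 0 ^ 2 ≤ B) (h1 : b ^ 3 * a 1 ^ 2 ≤ B) :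
    ε ^ 3 / 8 * a 2 ^ 2
      ≤ energyDissipation ε (b ^ 2) 0 1 (ε / 2) (ε ^ 2 / 2) a c := by
  have hB : 0 ≤ B := le_trans (by positivity) h0
  have hε2 : 0 < ε ^ 2 := by positivity
  have hbB : b * B ≤ ε ^ 2 / 1000 := by
    linarith [mul_le_mul_of_nonneg_right hbD hB, mul_le_mul_of_nonneg_right hBD hε2.le]
  have hbε : b ≤ ε / 10 := by
    linarith [mul_le_mul_of_nonneg_right hD1 hε2.le, mul_le_mul_of_nonneg_left hε1 hε.le]
  have hb2 : b ^ 2 ≤ ε ^ 2 / 100 := by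
    linarith [pow_le_pow_left₀ hb.le hbε 2]
  have hb4 : b ^ 4 * a 0 ^ 2 ≤ b ^ 2 * (ε ^ 2 / 1000) := by
    linarith [mul_le_mul_of_nonneg_left h0 (by positivity : 0 ≤ b ^ 3),
      mul_le_mul_of_nonneg_left hbB (by positivity : 0 ≤ b ^ 2)]
  have hb8 : b ^ 8 * a 1 ^ 2 ≤ b ^ 4 * (ε ^ 2 / 1000) := by
    linarith [mul_le_mul_of_nonneg_left h1 (by positivity : 0 ≤ b ^ 5),
      mul_le_mul_of_nonneg_left hbB (by positivity : 0 ≤ b ^ 4)]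
  have hb2ε2 := mul_le_mul_of_nonneg_right hb2 hε2.le
  have hε4 : 0 < ε ^ 4 := by positivity
  have hεb : 0 < ε ^ 2 * b ^ 4 := by positivity
  have q1 := quadForm_nonneg (A := 6 * b ^ 4 * a 1) (p := ε / 4) (q := ε * b ^ 4 / 8)
    (by positivity) (by linarith) (a 0 * a 1) (c 2)
  have q2 := quadForm_nonneg (A := 3 * b ^ 4 * a 0 ^ 2) (p := ε ^ 3 / 64) (q := ε * b ^ 4 / 64)
    (by positivity)
    (by
      have := pow_le_pow_left₀ (by positivity) hb4 2
      have : 0 ≤ b ^ 4 * ε ^ 4 := by positivity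
      linarith) (a 2) (c 2)
  have q3 := quadForm_nonneg (A := 3 * b ^ 2 * a 0) (p := ε / 4) (q := ε * b ^ 2 / 8)
    (by positivity) (by linarith [mul_pos (pow_pos hb 2) hε2]) (a 0 * a 1) (c 1)
  have q4 := quadForm_nonneg (A := -(3 * b ^ 2 * a 0)) (p := ε / 4) (q := ε ^ 3 / 64)
    (by positivity) (by linarith) (a 0 * a 1) (a 2)
  have q5 := quadForm_nonneg (A := -(ε / 2 * b ^ 2)) (p := ε * b ^ 2 / 8) (q := ε ^ 3 / 64)
    (by positivity)
    (by linarith [mul_le_mul_of_nonneg_left hb2 (by positivity : 0 ≤ ε ^ 2 * b ^ 2),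
      (by positivity : 0 < ε ^ 4 * b ^ 2)]) (c 1) (a 2)
  have q6 := quadForm_nonneg (A := ε) (p := ε / 2) (q := ε / 2) (by positivity) (by linarith)
    (a 0 * a 1) (c 0)
  have q7 := quadForm_nonneg (A := -ε ^ 2) (p := ε) (q := ε ^ 3 / 4) hε (by linarith)
    (a 0 * a 1) (a 2)
  have r1 : 0 ≤ ε * (a 0 * a 1) ^ 2 := by positivity
  have r2 : 0 ≤ ε ^ 3 * a 2 ^ 2 := by positivity
  have r3 : 0 ≤ ε * b ^ 2 * c 1 ^ 2 := by positivity
  have r4 : 0 ≤ ε * b ^ 4 * c 2 ^ 2 := by positivity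
  simp only [energyDissipation]
  linarith

/-- `β² ∫₀ᵗ ‖∂ₓ²u‖² ds ≤ C ε⁵` for the Rosenau–KdV–RLW approximation (★). -/
theorem uxx_l2_bound_KdVRLW (C0 : ℝ) (hC0 : 0 < C0) :
    ∃ D : ℝ, 0 < D ∧ ∃ C : ℝ, 0 < C ∧
      ∀ ε β : ℝ, 0 < ε → 0 < β → β ≤ D ^ 2 * ε ^ 4 →
        ∀ u : ℝ → ℝ → ℝ, IsAdmissibleKdVRLW ε β u →
          DataBoundsKdVRLW ε β C0 (u 0) →
          ∀ t > (0 : ℝ),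
            β ^ 2 * (∫ s in (0 : ℝ)..t, sqL2 (fun x => mixedD u 0 2 s x)) ≤ C * ε ^ 5 := by
  set D : ℝ := 1 / (2000 * (1 + C0)) with hD
  have hD0 : 0 < D := by positivity
  have hDeq : D * (2000 * (1 + C0)) = 1 := by rw [hD]; field_simp
  have hD1 : D ≤ 1 / 10 := by nlinarith [mul_pos hD0 hC0]
  have hDC : 2 * C0 * D ≤ 1 / 1000 := by nlinarith
  refine ⟨D, hD0, 8 * C0 + 8 * C0 ^ 2, by positivity, fun ε β hε hβ hβD u hu hdata t ht => ?_⟩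
  obtain ⟨b, hb, rfl⟩ : ∃ b : ℝ, 0 < b ∧ β = b ^ 2 := ⟨√β, sqrt_pos.2 hβ, (sq_sqrt hβ.le).symm⟩
  have hbD : b ≤ D * ε ^ 2 := le_of_sq_le_sq (hβD.trans (by ring_nf; rfl)) (by positivity)
  have hbε : b ≤ ε ^ 2 := hbD.trans (by nlinarith [sq_nonneg ε])
  obtain ⟨d1, d2, d3⟩ := hdata.jet_bounds hu hε.le hβ.le
  have sup {s : ℝ} (hs : 0 < s) (x : ℝ) := hu.sup_bounds hε.le hb hdata hs.le x
  have hsq : (fun s => sqL2 fun x => mixedD u 0 2 s x)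
      = fun s => sqL2 fun x => jet (Function.uncurry u) 0 2 (s, x) := by
    simp only [mixedD_eq_jet hu.smooth]
  rw [hsq]
  have conclude {c B : ℝ} (hB : 0 ≤ B)
      (h : ∀ R : ℝ, 0 ≤ R → ∃ E : ℝ, 0 ≤ E ∧
        E + (∫ s in 0..t, ∫ x in -R..R, c * jet (Function.uncurry u) 0 2 (s, x) ^ 2) ≤ B) :
      c * (∫ s in 0..t, sqL2 (fun x => jet (Function.uncurry u) 0 2 (s, x))) ≤ B :=
    mul_integral_sqL2_le_s8 ht.le hB (contDiff_jet hu.smooth 0 2).continuous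
      (fun s hs => hu.integrable_sq_jet (by norm_num) hs.1) fun R hR => by
        obtain ⟨E, hE, h⟩ := h R hR
        linarith
  have i0 : 0 ≤ ∫ x, jet (Function.uncurry u) 0 0 (0, x) ^ 2 := integral_nonneg fun x => sq_nonneg _
  have i1 : 0 ≤ ∫ x, jet (Function.uncurry u) 0 1 (0, x) ^ 2 := integral_nonneg fun x => sq_nonneg _
  have i4 : 0 ≤ ∫ x, jet (Function.uncurry u) 0 0 (0, x) ^ 4 :=
    integral_nonneg fun x => by positivity
  have hE {l m k n R : ℝ} (hl : 0 ≤ l) (hm : 0 ≤ m) (hk : 0 ≤ k) (hn : 0 ≤ n) (hR : 0 ≤ R) :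
      0 ≤ ∫ x in -R..R, energyDensity ε (b ^ 2) l m k n
        (fun i => jet (Function.uncurry u) 0 i (t, x)) :=
    intervalIntegral.integral_nonneg (by linarith) fun x _ =>
      energyDensity_nonneg hε.le hβ.le hl hm hk hn _
  set I0 := ∫ x, jet (Function.uncurry u) 0 0 (0, x) ^ 2
  set I1 := ∫ x, jet (Function.uncurry u) 0 1 (0, x) ^ 2
  set I2 := ∫ x, jet (Function.uncurry u) 0 2 (0, x) ^ 2
  set I3 := ∫ x, jet (Function.uncurry u) 0 3 (0, x) ^ 2
  set I4 := ∫ x, jet (Function.uncurry u) 0 0 (0, x) ^ 4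
  have j1 : 0 ≤ ε ^ 2 * I1 := by positivity
  have j2 : 0 ≤ b ^ 2 * I1 := by positivity
  have hε5 : 0 ≤ ε ^ 5 := by positivity
  have hb4 : b ^ 4 ≤ ε ^ 8 := (pow_le_pow_left₀ hb.le hbε 4).trans_eq (by ring)
  rcases le_total ε 1 with h1 | h1
  · have key := conclude (c := ε ^ 3 / 8) (B := C0) hC0.le fun R hR =>
      ⟨_, hE le_rfl zero_le_one (by positivity) (by positivity) hR,
        hu.energy_le_s8 hε.le hβ.le (l := 0) (m := 1) (k := ε / 2) (n := ε ^ 2 / 2) le_rfl zero_le_one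
          (by positivity) (by positivity) (by positivity)
          (fun s hs x => le_energyDissipation_of_le_one
            (a := fun i => jet (Function.uncurry u) 0 i (s, x)) hε h1 hb hD1 hDC hbD
            (sup hs x).1 (sup hs x).2) (by linarith) ht.le hR⟩
    set J := ∫ s in 0..t, sqL2 (fun x => jet (Function.uncurry u) 0 2 (s, x))
    have e1 : (b ^ 2) ^ 2 * J = 8 * b ^ 4 / ε ^ 3 * (ε ^ 3 / 8 * J) := by field_simp
    calc (b ^ 2) ^ 2 * J = 8 * b ^ 4 / ε ^ 3 * (ε ^ 3 / 8 * J) := e1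
      _ ≤ 8 * b ^ 4 / ε ^ 3 * C0 := by gcongr
      _ ≤ 8 * ε ^ 8 / ε ^ 3 * C0 := by gcongr
      _ = 8 * C0 * ε ^ 5 := by field_simp
      _ ≤ (8 * C0 + 8 * C0 ^ 2) * ε ^ 5 := by gcongr; linarith [sq_nonneg C0]
  · have k1 : I1 + b ^ 2 * I2 + (b ^ 2) ^ 2 * I3 ≤ 2 * C0 / ε ^ 2 := by
      rw [le_div_iff₀ (by positivity)]
      linarith
    have k2 : I0 + b ^ 2 * I1 + (b ^ 2) ^ 2 * I2 ≤ 2 * C0 := by linarith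
    have k3 := mul_le_mul_of_nonneg_left k2
      (by positivity : 0 ≤ 2 * (2 * C0) / (ε ^ 2 * b) / 2)
    have key := conclude (c := ε / 2)
      (B := 2 * (2 * C0) / (ε ^ 2 * b) / 2 * (2 * C0) + 1 / 2 * (2 * C0 / ε ^ 2))
      (by positivity) fun R hR =>
      ⟨_, hE (by positivity) le_rfl le_rfl zero_le_one hR,
        hu.energy_le_s8 hε.le hβ.le (l := 2 * (2 * C0) / (ε ^ 2 * b)) (m := 0) (k := 0) (n := 1)
          (by positivity) le_rfl le_rfl zero_le_one (by positivity)
          (fun s hs x => le_energyDissipation_of_one_le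
            (a := fun i => jet (Function.uncurry u) 0 i (s, x)) hε hb (sup hs x).1) (by linarith)
          ht.le hR⟩
    set J := ∫ s in 0..t, sqL2 (fun x => jet (Function.uncurry u) 0 2 (s, x))
    have e1 : (b ^ 2) ^ 2 * J = 2 * b ^ 4 / ε * (ε / 2 * J) := by field_simp
    have hb3 : b ^ 3 ≤ ε ^ 6 := (pow_le_pow_left₀ hb.le hbε 3).trans_eq (by ring)
    have hε35 : ε ^ 3 ≤ ε ^ 5 := pow_le_pow_right₀ h1 (by norm_num)
    calc (b ^ 2) ^ 2 * J = 2 * b ^ 4 / ε * (ε / 2 * J) := e1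
      _ ≤ 2 * b ^ 4 / ε *
          (2 * (2 * C0) / (ε ^ 2 * b) / 2 * (2 * C0) + 1 / 2 * (2 * C0 / ε ^ 2)) := by gcongr
      _ = 8 * C0 ^ 2 * (b ^ 3 / ε ^ 3) + 2 * C0 * (b ^ 4 / ε ^ 3) := by field_simp; ring
      _ ≤ 8 * C0 ^ 2 * (ε ^ 6 / ε ^ 3) + 2 * C0 * (ε ^ 8 / ε ^ 3) := by gcongr
      _ = 8 * C0 ^ 2 * ε ^ 3 + 2 * C0 * ε ^ 5 := by field_simp
      _ ≤ 8 * C0 ^ 2 * ε ^ 5 + 2 * C0 * ε ^ 5 := by gcongr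
      _ ≤ (8 * C0 + 8 * C0 ^ 2) * ε ^ 5 := by linarith [mul_nonneg hC0.le hε5]

end
end
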